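/- Planar graphs have bounded local treewidth: there is a function f (one may take f(r) = 3r) such that for every planar graph G, every vertex v, and every radius r, the treewidth of G[N^r_G[v]] is at most f(r). -/

import Mathlib

def hasTreewidthAtMost {V : Type*} (G : SimpleGraph V) (w : ℕ) : Prop :=
  ∃ (T : Type) (Tg : SimpleGraph T) (β : T → Set V),
    Tg.IsTree ∧
    (∀ v : V, ∃ x, v ∈ β x) ∧
    (∀ u v : V, G.Adj u v → ∃ x, u ∈ β x ∧ v ∈ β x) ∧
    (∀ v : V, (Tg.induce {x | v ∈ β x}).Connected) ∧
    (∀ x, (β x).ncard ≤ w + 1)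

/-- `H` is a minor of `G`: disjoint nonempty connected branch sets realizing the
edges of `H`. -/
def HasMinor {V W : Type*} (G : SimpleGraph V) (H : SimpleGraph W) : Prop :=
  ∃ B : W → Set V,
    (∀ w, (B w).Nonempty) ∧
    (∀ w, (G.induce (B w)).Connected) ∧
    (∀ w w', w ≠ w' → Disjoint (B w) (B w')) ∧
    (∀ w w', H.Adj w w' → ∃ u ∈ B w, ∃ v ∈ B w', G.Adj u v)

/-- Planarity via Wagner's theorem: no `K₅` and no `K₃,₃` minor. -/
def Planar {V : Type*} (G : SimpleGraph V) : Prop :=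
  ¬ HasMinor G (⊤ : SimpleGraph (Fin 5)) ∧
  ¬ HasMinor G (completeBipartiteGraph (Fin 3) (Fin 3))

namespace LocalTreewidth

open SimpleGraph

/-! ### Connected sets and minors -/

section

variable {V W : Type*} {G : SimpleGraph V}

/-- `x` and `y` are joined by a walk inside `S`. -/
def Joined (G : SimpleGraph V) (S : Set V) (x y : V) : Prop :=
  ∃ p : G.Walk x y, ∀ z ∈ p.support, z ∈ S

/-- Any two vertices of `S` are joined inside `S`; the empty set is allowed. -/
def ConnOn (G : SimpleGraph V) (S : Set V) : Prop := ∀ x ∈ S, ∀ y ∈ S, Joined G S x y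

/-- Some edge of `G` runs between `A` and `B`. -/
def Touch (G : SimpleGraph V) (A B : Set V) : Prop := ∃ a ∈ A, ∃ b ∈ B, G.Adj a b

theorem Touch.symm {A B : Set V} (h : Touch G A B) : Touch G B A :=
  let ⟨a, ha, b, hb, hab⟩ := h; ⟨b, hb, a, ha, hab.symm⟩

theorem Touch.mono {A B A' B' : Set V} (h : Touch G A B) (hA : A ⊆ A') (hB : B ⊆ B') :
    Touch G A' B' :=
  let ⟨a, ha, b, hb, hab⟩ := h; ⟨a, hA ha, b, hB hb, hab⟩

theorem Joined.refl {S : Set V} {x : V} (hx : x ∈ S) : Joined G S x x :=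
  ⟨.nil, by simpa using hx⟩

theorem Joined.right_mem {S : Set V} {x y : V} (h : Joined G S x y) : y ∈ S :=
  let ⟨p, hp⟩ := h; hp _ p.end_mem_support

theorem Joined.symm {S : Set V} {x y : V} (h : Joined G S x y) : Joined G S y x :=
  let ⟨p, hp⟩ := h; ⟨p.reverse, by simpa using hp⟩

theorem Joined.trans {S : Set V} {x y z : V} (h : Joined G S x y) (h' : Joined G S y z) :
    Joined G S x z := by
  obtain ⟨p, hp⟩ := h
  obtain ⟨q, hq⟩ := h'
  refine ⟨p.append q, fun w hw => ?_⟩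
  rw [Walk.mem_support_append_iff] at hw
  exact hw.elim (hp w) (hq w)

theorem Joined.mono {S T : Set V} {x y : V} (h : Joined G S x y) (hST : S ⊆ T) :
    Joined G T x y :=
  let ⟨p, hp⟩ := h; ⟨p, fun z hz => hST (hp z hz)⟩

theorem Joined.of_adj {S : Set V} {x y : V} (hx : x ∈ S) (hy : y ∈ S) (h : G.Adj x y) :
    Joined G S x y :=
  ⟨h.toWalk, by simp [hx, hy]⟩

theorem Joined.exit {S A : Set V} {x y : V} (h : Joined G S x y) (hx : x ∈ A) (hy : y ∉ A) :
    ∃ a b, a ∈ S ∧ a ∈ A ∧ b ∈ S ∧ b ∉ A ∧ G.Adj a b := by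
  obtain ⟨p, hp⟩ := h
  obtain ⟨d, hd, h1, h2⟩ := p.exists_boundary_dart A hx hy
  exact ⟨d.fst, d.snd, hp _ (p.dart_fst_mem_support_of_mem_darts hd), h1,
    hp _ (p.dart_snd_mem_support_of_mem_darts hd), h2, d.adj⟩

theorem connOn_singleton (x : V) : ConnOn G {x} := by
  rintro _ rfl _ rfl
  exact Joined.refl rfl

theorem connOn_empty : ConnOn G ∅ := fun _ h => h.elim

theorem ConnOn.of_center {S : Set V} {c : V} (h : ∀ x ∈ S, Joined G S c x) : ConnOn G S :=
  fun x hx y hy => (h x hx).symm.trans (h y hy)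

theorem ConnOn.union {A B : Set V} (hA : ConnOn G A) (hB : ConnOn G B) (h : Touch G A B) :
    ConnOn G (A ∪ B) := by
  obtain ⟨a, ha, b, hb, hab⟩ := h
  apply ConnOn.of_center (c := a)
  rintro x (hx | hx)
  · exact (hA a ha x hx).mono Set.subset_union_left
  · exact (Joined.of_adj (.inl ha) (.inr hb) hab).trans
      ((hB b hb x hx).mono Set.subset_union_right)

theorem ConnOn.insert {A : Set V} {a b : V} (hA : ConnOn G A) (hb : b ∈ A) (hab : G.Adj a b) :
    ConnOn G (insert a A) :=
  (connOn_singleton a).union hA ⟨a, rfl, b, hb, hab⟩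

/-- The component of `x` inside `S`. -/
def comp (G : SimpleGraph V) (S : Set V) (x : V) : Set V := {y | Joined G S x y}

theorem comp_subset {S : Set V} {x : V} : comp G S x ⊆ S := fun _ h => h.right_mem

theorem self_mem_comp {S : Set V} {x : V} (hx : x ∈ S) : x ∈ comp G S x := Joined.refl hx

theorem comp_closed {S : Set V} {x y z : V} (hy : y ∈ comp G S x) (hz : z ∈ S)
    (h : G.Adj y z) : z ∈ comp G S x :=
  hy.trans (Joined.of_adj hy.right_mem hz h)

theorem connOn_comp {S : Set V} {x : V} : ConnOn G (comp G S x) := by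
  classical
  apply ConnOn.of_center (c := x)
  rintro y ⟨p, hp⟩
  refine ⟨p, fun z hz => ⟨p.takeUntil z hz, fun w hw => hp w ?_⟩⟩
  exact p.support_takeUntil_subset_support hz hw

theorem ConnOn.preconnected {S : Set V} (h : ConnOn G S) : (G.induce S).Preconnected := by
  rintro ⟨x, hx⟩ ⟨y, hy⟩
  obtain ⟨p, hp⟩ := h x hx y hy
  exact ⟨p.induce S hp⟩

theorem connOn_of_preconnected {S : Set V} (h : (G.induce S).Preconnected) : ConnOn G S := by
  intro x hx y hy
  obtain ⟨p⟩ := h ⟨x, hx⟩ ⟨y, hy⟩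
  have key : ∀ z ∈ (p.map (SimpleGraph.Embedding.induce S).toHom).support, z ∈ S := by
    intro z hz
    rw [Walk.support_map] at hz
    obtain ⟨w, -, rfl⟩ := List.mem_map.1 hz
    exact w.2
  exact ⟨_, key⟩

theorem connected_induce_iff {S : Set V} :
    (G.induce S).Connected ↔ S.Nonempty ∧ ConnOn G S := by
  rw [SimpleGraph.connected_iff, ← Set.nonempty_coe_sort]
  exact ⟨fun h => ⟨h.2, connOn_of_preconnected h.1⟩, fun h => ⟨h.2.preconnected, h.1⟩⟩

/-- A nonempty connected vertex set. -/
def Blob (G : SimpleGraph V) (S : Set V) : Prop := S.Nonempty ∧ ConnOn G S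

theorem blob_singleton (x : V) : Blob G {x} := ⟨⟨x, rfl⟩, connOn_singleton x⟩

theorem hasMinor_iff {H : SimpleGraph W} : HasMinor G H ↔ ∃ B : W → Set V,
    (∀ w, Blob G (B w)) ∧ (∀ w w', w ≠ w' → Disjoint (B w) (B w')) ∧
    (∀ w w', H.Adj w w' → Touch G (B w) (B w')) := by
  constructor
  · rintro ⟨B, h1, h2, h3, h4⟩
    exact ⟨B, fun w => connected_induce_iff.1 (h2 w), h3, h4⟩
  · rintro ⟨B, h1, h3, h4⟩
    exact ⟨B, fun w => (h1 w).1, fun w => connected_induce_iff.2 (h1 w), h3, h4⟩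

theorem hasMinor_K33 {A B : Fin 3 → Set V} (hA : ∀ i, Blob G (A i)) (hB : ∀ i, Blob G (B i))
    (hAA : ∀ i j, i ≠ j → Disjoint (A i) (A j)) (hBB : ∀ i j, i ≠ j → Disjoint (B i) (B j))
    (hAB : ∀ i j, Disjoint (A i) (B j)) (h : ∀ i j, Touch G (A i) (B j)) :
    HasMinor G (completeBipartiteGraph (Fin 3) (Fin 3)) := by
  refine hasMinor_iff.2 ⟨Sum.elim A B, ?_, ?_, ?_⟩
  · rintro (i | i)
    exacts [hA i, hB i]
  · rintro (i | i) (j | j) hij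
    · exact hAA i j fun e => hij (e ▸ rfl)
    · exact hAB i j
    · exact (hAB j i).symm
    · exact hBB i j fun e => hij (e ▸ rfl)
  · rintro (i | i) (j | j) hij
    · simp at hij
    · exact h i j
    · exact (h j i).symm
    · simp at hij

theorem not_K33 (hG : Planar G) {A₀ A₁ A₂ B₀ B₁ B₂ : Set V}
    (a₀ : Blob G A₀) (a₁ : Blob G A₁) (a₂ : Blob G A₂)
    (b₀ : Blob G B₀) (b₁ : Blob G B₁) (b₂ : Blob G B₂)
    (da : Disjoint A₀ A₁ ∧ Disjoint A₀ A₂ ∧ Disjoint A₁ A₂)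
    (db : Disjoint B₀ B₁ ∧ Disjoint B₀ B₂ ∧ Disjoint B₁ B₂)
    (d₀ : Disjoint A₀ B₀ ∧ Disjoint A₀ B₁ ∧ Disjoint A₀ B₂)
    (d₁ : Disjoint A₁ B₀ ∧ Disjoint A₁ B₁ ∧ Disjoint A₁ B₂)
    (d₂ : Disjoint A₂ B₀ ∧ Disjoint A₂ B₁ ∧ Disjoint A₂ B₂)
    (t₀ : Touch G A₀ B₀ ∧ Touch G A₀ B₁ ∧ Touch G A₀ B₂)
    (t₁ : Touch G A₁ B₀ ∧ Touch G A₁ B₁ ∧ Touch G A₁ B₂)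
    (t₂ : Touch G A₂ B₀ ∧ Touch G A₂ B₁ ∧ Touch G A₂ B₂) : False := by
  refine hG.2 (hasMinor_K33 (A := ![A₀, A₁, A₂]) (B := ![B₀, B₁, B₂]) ?_ ?_ ?_ ?_ ?_ ?_)
  · simp [Fin.forall_fin_succ, *]
  · simp [Fin.forall_fin_succ, *]
  · simp [Fin.forall_fin_succ, da, da.1.symm, da.2.1.symm, da.2.2.symm]
  · simp [Fin.forall_fin_succ, db, db.1.symm, db.2.1.symm, db.2.2.symm]
  · simp [Fin.forall_fin_succ, *]
  · simp [Fin.forall_fin_succ, *]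

theorem not_K5 (hG : Planar G) {A₀ A₁ A₂ A₃ A₄ : Set V}
    (a₀ : Blob G A₀) (a₁ : Blob G A₁) (a₂ : Blob G A₂) (a₃ : Blob G A₃) (a₄ : Blob G A₄)
    (d₀ : Disjoint A₀ A₁ ∧ Disjoint A₀ A₂ ∧ Disjoint A₀ A₃ ∧ Disjoint A₀ A₄)
    (d₁ : Disjoint A₁ A₂ ∧ Disjoint A₁ A₃ ∧ Disjoint A₁ A₄)
    (d₂ : Disjoint A₂ A₃ ∧ Disjoint A₂ A₄) (d₃ : Disjoint A₃ A₄)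
    (t₀ : Touch G A₀ A₁ ∧ Touch G A₀ A₂ ∧ Touch G A₀ A₃ ∧ Touch G A₀ A₄)
    (t₁ : Touch G A₁ A₂ ∧ Touch G A₁ A₃ ∧ Touch G A₁ A₄)
    (t₂ : Touch G A₂ A₃ ∧ Touch G A₂ A₄) (t₃ : Touch G A₃ A₄) : False := by
  refine hG.1 (hasMinor_iff.2 ⟨![A₀, A₁, A₂, A₃, A₄], ?_, ?_, ?_⟩)
  · simp [Fin.forall_fin_succ, *]
  · simp [Fin.forall_fin_succ, d₀, d₁, d₂, d₃, d₀.1.symm, d₀.2.1.symm, d₀.2.2.1.symm,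
      d₀.2.2.2.symm, d₁.1.symm, d₁.2.1.symm, d₁.2.2.symm, d₂.1.symm, d₂.2.symm, d₃.symm]
  · simp [Fin.forall_fin_succ, t₀, t₁, t₂, t₃, t₀.1.symm, t₀.2.1.symm, t₀.2.2.1.symm,
      t₀.2.2.2.symm, t₁.1.symm, t₁.2.1.symm, t₁.2.2.symm, t₂.1.symm, t₂.2.symm, t₃.symm]

end

/-! ### Cycles and weights -/

section

variable {V : Type*} {G : SimpleGraph V} {φ : V → V → ZMod 2}

/-- The sum of the edge weights `φ` along a walk. -/
def ws (φ : V → V → ZMod 2) : {x y : V} → G.Walk x y → ZMod 2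
  | _, _, .nil => 0
  | _, _, .cons (u := u) (v := v) _ p => φ u v + ws φ p

@[simp] theorem ws_nil (x : V) : ws φ (Walk.nil : G.Walk x x) = 0 := rfl

@[simp] theorem ws_cons {x y z : V} (h : G.Adj x y) (p : G.Walk y z) :
    ws φ (Walk.cons h p) = φ x y + ws φ p := rfl

@[simp] theorem ws_append {x y z : V} (p : G.Walk x y) (q : G.Walk y z) :
    ws φ (p.append q) = ws φ p + ws φ q := by
  induction p with
  | nil => simp
  | cons h p ih => simp [ih, add_assoc]

@[simp] theorem ws_reverse (hφ : ∀ x y, φ x y = φ y x) {x y : V} (p : G.Walk x y) :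
    ws φ p.reverse = ws φ p := by
  induction p with
  | nil => simp
  | cons h p ih => simp [ih, hφ, add_comm]

/-- A closed walk of length at least three without repeated vertices. -/
def Cyc {x : V} (c : G.Walk x x) : Prop := 3 ≤ c.length ∧ c.support.tail.Nodup

/-- Two closed walks with the same vertices and the same weight. -/
def Same {x y : V} (c : G.Walk x x) (d : G.Walk y y) : Prop :=
  (∀ φ : V → V → ZMod 2, (∀ x y, φ x y = φ y x) → ws φ c = ws φ d) ∧
    ∀ z, z ∈ c.support ↔ z ∈ d.support

theorem Same.trans {x y z : V} {c : G.Walk x x} {d : G.Walk y y} {e : G.Walk z z}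
    (h : Same c d) (h' : Same d e) : Same c e :=
  ⟨fun φ hφ => (h.1 φ hφ).trans (h'.1 φ hφ), fun z => (h.2 z).trans (h'.2 z)⟩

theorem cyc_append_iff {x y : V} {α : G.Walk x y} {β : G.Walk y x} :
    Cyc (α.append β) ↔ 3 ≤ α.length + β.length ∧ (α.support.tail ++ β.support.tail).Nodup := by
  rw [Cyc, Walk.length_append, Walk.tail_support_append]

theorem Cyc.swap {x y : V} {α : G.Walk x y} {β : G.Walk y x} (h : Cyc (α.append β)) :
    Cyc (β.append α) := by
  rw [cyc_append_iff] at h ⊢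
  exact ⟨by omega, (List.perm_append_comm.nodup_iff).1 h.2⟩

theorem same_swap {x y : V} (α : G.Walk x y) (β : G.Walk y x) :
    Same (α.append β) (β.append α) :=
  ⟨fun φ _ => by simp [add_comm], fun z => by simp [or_comm]⟩

theorem end_mem_tail_support {x y : V} (p : G.Walk x y) (h : x ≠ y) : y ∈ p.support.tail := by
  have := p.end_mem_support
  rw [← p.cons_tail_support, List.mem_cons] at this
  exact this.resolve_left h.symm

theorem mem_tail_support {x y z : V} {p : G.Walk x y} (hz : z ∈ p.support) (h : z ≠ x) :
    z ∈ p.support.tail := by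
  rw [← p.cons_tail_support, List.mem_cons] at hz
  exact hz.resolve_left h

theorem Cyc.isPath_left {x y : V} {α : G.Walk x y} {β : G.Walk y x} (h : Cyc (α.append β))
    (hxy : x ≠ y) : α.IsPath := by
  rw [cyc_append_iff, List.nodup_append] at h
  rw [Walk.isPath_def, ← α.cons_tail_support, List.nodup_cons]
  exact ⟨fun hx => h.2.2.2 x hx x (end_mem_tail_support β hxy.symm) rfl, h.2.1⟩

theorem Cyc.isPath_right {x y : V} {α : G.Walk x y} {β : G.Walk y x} (h : Cyc (α.append β))
    (hxy : x ≠ y) : β.IsPath :=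
  h.swap.isPath_left hxy.symm

theorem Cyc.eq_or_eq {x y z : V} {α : G.Walk x y} {β : G.Walk y x} (h : Cyc (α.append β))
    (h1 : z ∈ α.support) (h2 : z ∈ β.support) : z = x ∨ z = y := by
  by_contra! hz
  rw [cyc_append_iff, List.nodup_append] at h
  exact h.2.2.2 z (mem_tail_support h1 hz.1) z (mem_tail_support h2 hz.2) rfl

theorem Cyc.theta {x y : V} {α : G.Walk x y} {β : G.Walk y x} (h : Cyc (α.append β))
    (hxy : x ≠ y) {P : G.Walk y x} (hP : P.IsPath)
    (hd : ∀ z ∈ P.support, z ∈ α.support → z = x ∨ z = y) (hl : 3 ≤ α.length + P.length) :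
    Cyc (α.append P) := by
  have hα := h.isPath_left hxy
  rw [Walk.isPath_def] at hα hP
  rw [cyc_append_iff, List.nodup_append]
  refine ⟨hl, hα.tail, hP.tail, ?_⟩
  rintro z hz _ hz' rfl
  rw [← α.cons_tail_support, List.nodup_cons] at hα
  rw [← P.cons_tail_support, List.nodup_cons] at hP
  rcases hd z (List.mem_of_mem_tail hz') (List.mem_of_mem_tail hz) with rfl | rfl
  · exact hα.1 hz
  · exact hP.1 hz'

theorem Cyc.rotate {u x : V} {c : G.Walk u u} (h : Cyc c) (hx : x ∈ c.support) :
    ∃ d : G.Walk x x, Cyc d ∧ Same c d := by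
  classical
  have hc := c.take_spec hx
  rw [← hc] at h ⊢
  exact ⟨_, h.swap, same_swap _ _⟩

theorem Cyc.split {u x y : V} {c : G.Walk u u} (h : Cyc c) (hx : x ∈ c.support)
    (hy : y ∈ c.support) :
    ∃ (α : G.Walk x y) (β : G.Walk y x), Cyc (α.append β) ∧ Same c (α.append β) := by
  classical
  obtain ⟨d, hd, hs⟩ := h.rotate hx
  rw [hs.2] at hy
  exact ⟨d.takeUntil y hy, d.dropUntil y hy, by rwa [d.take_spec hy], by rwa [d.take_spec hy]⟩

theorem exists_first_mem {X : Set V} {x y : V} (p : G.Walk x y) (h : ∃ z ∈ p.support, z ∈ X) :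
    ∃ (b : V) (q : G.Walk x b) (r : G.Walk b y), p = q.append r ∧ b ∈ X ∧
      ∀ z ∈ q.support, z ∈ X → z = b := by
  induction p with
  | nil => exact ⟨_, .nil, .nil, rfl, by simpa using h, by simp⟩
  | @cons u v w a p ih =>
    by_cases hu : u ∈ X
    · exact ⟨u, .nil, .cons a p, rfl, hu, by simp⟩
    · obtain ⟨b, q, r, rfl, hb, hq⟩ := ih (by
        obtain ⟨z, hz, hzX⟩ := h
        rw [Walk.support_cons, List.mem_cons] at hz
        rcases hz with rfl | hz
        exacts [absurd hzX hu, ⟨z, hz, hzX⟩])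
      refine ⟨b, .cons a q, r, rfl, hb, fun z hz hzX => ?_⟩
      rw [Walk.support_cons, List.mem_cons] at hz
      rcases hz with rfl | hz
      exacts [absurd hzX hu, hq z hz hzX]

theorem exists_last_mem {X : Set V} {x y : V} (p : G.Walk x y) (h : ∃ z ∈ p.support, z ∈ X) :
    ∃ (b : V) (q : G.Walk x b) (r : G.Walk b y), p = q.append r ∧ b ∈ X ∧
      ∀ z ∈ r.support, z ∈ X → z = b := by
  obtain ⟨b, q, r, hp, hb, hq⟩ := exists_first_mem (X := X) p.reverse (by simpa using h)
  refine ⟨b, r.reverse, q.reverse, ?_, hb, by simpa using hq⟩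
  rw [← Walk.reverse_append, ← hp, Walk.reverse_reverse]

theorem Cyc.segment {u z : V} {c : G.Walk u u} (h : Cyc c) {X : Set V} (hz : z ∈ c.support)
    (hzX : z ∉ X) (hX : ∃ a ∈ c.support, ∃ b ∈ c.support, a ≠ b ∧ a ∈ X ∧ b ∈ X) :
    ∃ (b₁ b₂ : V) (β : G.Walk b₂ b₁) (σ : G.Walk b₁ b₂), b₁ ≠ b₂ ∧ b₁ ∈ X ∧ b₂ ∈ X ∧
      Cyc (β.append σ) ∧ Same c (β.append σ) ∧ z ∈ β.support ∧
      ∀ w ∈ β.support, w ∈ X → w = b₁ ∨ w = b₂ := by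
  obtain ⟨d, hd, hs⟩ := h.rotate hz
  obtain ⟨a, ha, b, hb, hab, haX, hbX⟩ := hX
  rw [hs.2] at ha hb
  obtain ⟨b₁, p, q, rfl, hb₁, hp⟩ := exists_first_mem d ⟨a, ha, haX⟩
  obtain ⟨b₂, σ, r, rfl, hb₂, hr⟩ := exists_last_mem (X := X) q ⟨b₁, by simp, hb₁⟩
  have hC : Cyc ((r.append p).append σ) := by
    have : Cyc ((p.append σ).append r) := by rwa [← Walk.append_assoc]
    have := this.swap
    rwa [Walk.append_assoc] at this
  have hS : Same (p.append (σ.append r)) ((r.append p).append σ) := by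
    rw [Walk.append_assoc, ← Walk.append_assoc r]
    exact same_swap _ _
  have hne : b₁ ≠ b₂ := by
    rintro rfl
    have hz1 : z ≠ b₁ := by rintro rfl; exact hzX hb₁
    have hn := (cyc_append_iff.1 hC).2
    rw [List.nodup_append, Walk.tail_support_append] at hn
    have hσ : ∀ w ∈ σ.support, w = b₁ := by
      intro w hw
      by_contra hwb
      have h1 := mem_tail_support hw hwb
      have h2 : b₁ ∈ σ.support.tail := by
        cases σ with
        | nil => simp at h1
        | cons _ s => simp
      exact hn.2.2 b₁ (List.mem_append_right _ (end_mem_tail_support p hz1)) b₁ h2 rfl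
    have key : ∀ w ∈ (p.append (σ.append r)).support, w ∈ X → w = b₁ := by
      intro w hw hwX
      simp only [Walk.mem_support_append_iff] at hw
      rcases hw with hw | hw | hw
      exacts [hp w hw hwX, hσ w hw, hr w hw hwX]
    exact hab ((key a ha haX).trans (key b hb hbX).symm)
  refine ⟨b₁, b₂, r.append p, σ, hne, hb₁, hb₂, hC, hs.trans hS, by simp, ?_⟩
  intro w hw hwX
  rw [Walk.mem_support_append_iff] at hw
  rcases hw with hw | hw
  exacts [.inr (hr w hw hwX), .inl (hp w hw hwX)]

theorem ws_eq_bypass [DecidableEq V] (hφ : ∀ x y, φ x y = φ y x) {S : Set V}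
    (hS : ∀ x (c : G.Walk x x), Cyc c → (∀ z ∈ c.support, z ∈ S) → ws φ c = 0)
    {x y : V} (p : G.Walk x y) (hp : ∀ z ∈ p.support, z ∈ S) : ws φ p = ws φ p.bypass := by
  induction p with
  | nil => rfl
  | @cons u v w a p ih =>
    have ih := ih fun z hz => hp z (by simp [hz])
    rw [Walk.bypass]
    split_ifs with hu
    · have hsp := p.bypass.take_spec hu
      have hpath : (p.bypass.takeUntil u hu).IsPath := p.bypass_isPath.takeUntil hu
      have hsub : ∀ z ∈ (p.bypass.takeUntil u hu).support, z ∈ S := fun z hz =>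
        hp z (by
          rw [Walk.support_cons]
          exact List.mem_cons_of_mem _ (p.support_bypass_subset_support
            (p.bypass.support_takeUntil_subset_support hu hz)))
      rw [ws_cons, ih]
      nth_rw 1 [← hsp]
      rw [ws_append, ← add_assoc]
      suffices φ u v + ws φ (p.bypass.takeUntil u hu) = 0 by rw [this, zero_add]
      generalize p.bypass.takeUntil u hu = t at hpath hsub
      by_cases hl : 2 ≤ t.length
      · rw [← ws_cons a t]
        refine hS _ _ ⟨by simp; omega, ?_⟩ ?_
        · simpa using hpath.support_nodup
        · intro z hz
          rw [Walk.support_cons, List.mem_cons] at hz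
          rcases hz with rfl | hz
          exacts [hsub _ t.end_mem_support, hsub _ hz]
      · cases t with
        | nil => exact (G.irrefl a).elim
        | cons b t =>
          cases t with
          | nil => simp [hφ v u, CharTwo.add_self_eq_zero]
          | cons _ _ => simp at hl
    · simp [ih]

theorem ws_closed (hφ : ∀ x y, φ x y = φ y x) {S : Set V}
    (hS : ∀ x (c : G.Walk x x), Cyc c → (∀ z ∈ c.support, z ∈ S) → ws φ c = 0)
    {x : V} (c : G.Walk x x) (hc : ∀ z ∈ c.support, z ∈ S) : ws φ c = 0 := by
  classical
  rw [ws_eq_bypass hφ hS c hc,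
    Walk.eq_nil_iff_nil.2 (Walk.isPath_iff_nil.1 c.bypass_isPath), ws_nil]

theorem exists_potential (hφ : ∀ x y, φ x y = φ y x) {S : Set V} (hc : ConnOn G S)
    (hS : ∀ x (c : G.Walk x x), Cyc c → (∀ z ∈ c.support, z ∈ S) → ws φ c = 0) :
    ∃ p : V → ZMod 2, ∀ x ∈ S, ∀ y ∈ S, G.Adj x y → φ x y = p x + p y := by
  classical
  rcases S.eq_empty_or_nonempty with rfl | ⟨s, hs⟩
  · exact ⟨0, by simp⟩
  choose w hw using hc s hs
  refine ⟨fun x => if hx : x ∈ S then ws φ (w x hx) else 0, fun x hx y hy h => ?_⟩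
  have := ws_closed hφ hS ((w x hx).append (.cons h (w y hy).reverse)) (by
    intro z hz
    simp only [Walk.mem_support_append_iff, Walk.support_cons, List.mem_cons,
      Walk.support_reverse, List.mem_reverse] at hz
    rcases hz with hz | rfl | hz
    exacts [hw x hx z hz, hx, hw y hy z hz])
  simp only [ws_append, ws_cons, ws_reverse hφ] at this
  simp only [hx, hy, dif_pos]
  linear_combination this - (ws φ (w x hx) + ws φ (w y hy)) * CharTwo.two_eq_zero (R := ZMod 2)

theorem ws_eq_of_potential {S : Set V} {p : V → ZMod 2}
    (hp : ∀ x ∈ S, ∀ y ∈ S, G.Adj x y → φ x y = p x + p y) {x y : V} (q : G.Walk x y)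
    (hq : ∀ z ∈ q.support, z ∈ S) : ws φ q = p x + p y := by
  induction q with
  | nil => simp [CharTwo.add_self_eq_zero]
  | @cons u v w a q ih =>
    rw [ws_cons, ih fun z hz => hq z (by simp [hz]),
      hp u (hq u (by simp)) v (hq v (by simp)) a]
    linear_combination p v * CharTwo.two_eq_zero (R := ZMod 2)

end

/-! ### Peripheral cycles generate the cycle space -/

section

variable {V : Type*} {G : SimpleGraph V} {φ : V → V → ZMod 2}

/-- Deleting at most two vertices leaves `G` connected. -/
def ThreeConn (G : SimpleGraph V) : Prop := ∀ u w, ConnOn G {u, w}ᶜ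

/-- `S` is the vertex set of an induced cycle whose complement is connected. -/
def Peripheral (G : SimpleGraph V) (S : Set V) : Prop :=
  (∃ (x : V) (c : G.Walk x x), Cyc c ∧ ∀ z, z ∈ c.support ↔ z ∈ S) ∧
    (∀ x ∈ S, ∃ a b, ∀ y ∈ S, G.Adj x y → y = a ∨ y = b) ∧ ConnOn G Sᶜ

/-- There is a cycle inside `T` of odd weight. -/
def OddCyc (G : SimpleGraph V) (φ : V → V → ZMod 2) (T : Set V) : Prop :=
  ∃ (x : V) (c : G.Walk x x), Cyc c ∧ ws φ c = 1 ∧ ∀ z ∈ c.support, z ∈ T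

theorem zmod_two_cases (a : ZMod 2) : a = 0 ∨ a = 1 := by
  revert a; decide

theorem exists_inner {x y : V} {p : G.Walk x y} (hp : p.IsPath) (hl : 2 ≤ p.length) :
    ∃ z ∈ p.support, z ≠ x ∧ z ≠ y := by
  cases p with
  | nil => simp at hl
  | @cons _ v _ h q =>
    cases q with
    | nil => simp at hl
    | cons h' q =>
      refine ⟨v, by simp, h.ne', ?_⟩
      rintro rfl
      have := hp.of_cons
      rw [Walk.cons_isPath_iff] at this
      exact this.2 q.end_mem_support

theorem Cyc.theta_odd (hφ : ∀ x y, φ x y = φ y x) {x y : V} {α : G.Walk x y}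
    {β : G.Walk y x} (h : Cyc (α.append β)) (h1 : ws φ (α.append β) = 1) (hxy : x ≠ y)
    {P : G.Walk y x} (hP : P.IsPath)
    (hα : ∀ z ∈ P.support, z ∈ α.support → z = x ∨ z = y)
    (hβ : ∀ z ∈ P.support, z ∈ β.support → z = x ∨ z = y)
    (lα : 3 ≤ α.length + P.length) (lβ : 3 ≤ β.length + P.length) :
    OddCyc G φ {z | z ∈ α.support ∨ z ∈ P.support} ∨
      OddCyc G φ {z | z ∈ β.support ∨ z ∈ P.support} := by
  have hs : ws φ (α.append P) + ws φ (β.append P.reverse) = 1 := by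
    rw [← h1]
    simp only [ws_append, ws_reverse hφ]
    linear_combination ws φ P * CharTwo.two_eq_zero (R := ZMod 2)
  have c1 := h.theta hxy hP hα lα
  have c2 := h.swap.theta hxy.symm (P := P.reverse) hP.reverse
    (by simpa [or_comm] using hβ) (by simpa using lβ)
  rcases zmod_two_cases (ws φ (α.append P)) with h0 | h0
  · rw [h0, zero_add] at hs
    exact .inr ⟨_, _, c2, hs, by simp⟩
  · exact .inl ⟨_, _, c1, h0, by simp⟩

theorem exists_link {Z : Set V} (hZ : ConnOn G Z) {a b : V} (ha : a ∉ Z) (hb : b ∉ Z)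
    (hab : a ≠ b) (haZ : Touch G {a} Z) (hbZ : Touch G {b} Z) :
    ∃ P : G.Walk b a, P.IsPath ∧ 2 ≤ P.length ∧
      ∀ z ∈ P.support, z = a ∨ z = b ∨ z ∈ Z := by
  classical
  obtain ⟨_, rfl, x, hx, hax⟩ := haZ
  obtain ⟨_, rfl, y, hy, hby⟩ := hbZ
  obtain ⟨w, hw⟩ := hZ y hy x hx
  have hw' : ∀ z ∈ w.bypass.support, z ∈ Z := fun z hz => hw z (w.support_bypass_subset_support hz)
  refine ⟨.cons hby (w.bypass.concat hax.symm), ?_, by simp, ?_⟩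
  · rw [Walk.cons_isPath_iff]
    refine ⟨w.bypass_isPath.concat (fun h => ha (hw' _ h)) _, ?_⟩
    rw [Walk.support_concat]
    simp only [List.mem_append, List.mem_singleton, not_or]
    exact ⟨fun h => hb (hw' _ h), hab.symm⟩
  · intro z hz
    rw [Walk.support_cons, Walk.support_concat] at hz
    simp only [List.mem_cons, List.mem_append, List.mem_nil_iff, or_false] at hz
    rcases hz with rfl | hz | rfl
    exacts [.inr (.inl rfl), .inr (.inr (hw' _ hz)), .inl rfl]

/-- The vertices that can be added to the connected set `B`. -/
def extensions (G : SimpleGraph V) (B : Set V) : Set V :=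
  {b | b ∉ B ∧ (B = ∅ ∨ ∃ a ∈ B, G.Adj b a)}

theorem ThreeConn.exists_extension (h3 : ThreeConn G) {B : Set V} {b z u w : V} (hb : b ∈ B)
    (hz : z ∉ B) (hu : u ∉ B) (hw : w ∉ B) (hzu : z ≠ u) (hzw : z ≠ w) :
    ∃ x ∈ extensions G B, x ≠ u ∧ x ≠ w := by
  obtain ⟨a, x, -, ha, hx, hxB, hax⟩ := (h3 u w b (by
    rintro (rfl | rfl) <;> contradiction) z (by
    rintro (rfl | rfl) <;> contradiction)).exit hb hz
  refine ⟨x, ⟨hxB, .inr ⟨a, ha, hax.symm⟩⟩, ?_, ?_⟩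
  · rintro rfl; exact hx (.inl rfl)
  · rintro rfl; exact hx (.inr rfl)

theorem support_subset_extensions {B : Set V} (hφ : ∀ x y, φ x y = φ y x)
    (hmax : ∀ b ∈ extensions G B, ¬ OddCyc G φ (insert b B)ᶜ) (h3 : ThreeConn G) {x : V}
    {c : G.Walk x x} (hc : Cyc c)
    (h1 : ws φ c = 1) (hB : ∀ z ∈ c.support, z ∉ B) : ∀ z ∈ c.support, z ∈ extensions G B := by
  classical
  by_contra! hcon
  obtain ⟨z, hz, hzN⟩ := hcon
  have hon : ∀ b ∈ extensions G B, b ∈ c.support := by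
    intro b hb
    by_contra hbc
    exact hmax b hb ⟨x, c, hc, h1, fun t ht => by
      rintro (rfl | h)
      exacts [hbc ht, hB t ht h]⟩
  obtain ⟨b₀, hb₀⟩ : B.Nonempty := by
    by_contra hne
    exact hzN ⟨hB z hz, .inl (Set.not_nonempty_iff_eq_empty.1 hne)⟩
  obtain ⟨d, hd, hds⟩ := hc.rotate hz
  obtain ⟨v, hv, hvz⟩ : ∃ v ∈ c.support, v ≠ z := by
    cases d with
    | nil => simp [Cyc] at hd
    | @cons _ v _ a d => exact ⟨v, (hds.2 v).2 (by simp), a.ne'⟩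
  obtain ⟨a, ha, -⟩ := h3.exists_extension hb₀ (hB z hz) (hB v hv) (hB v hv) hvz.symm hvz.symm
  have hza : z ≠ a := by rintro rfl; exact hzN ha
  obtain ⟨b, hb, hba, -⟩ := h3.exists_extension hb₀ (hB z hz) ha.1 ha.1 hza hza
  obtain ⟨b₁, b₂, β, σ, hne, hb₁, hb₂, hC, hS, hzβ, hβ⟩ :=
    hc.segment hz hzN ⟨a, hon a ha, b, hon b hb, hba.symm, ha, hb⟩
  have hzb₁ : z ≠ b₁ := by rintro rfl; exact hzN hb₁
  have hzb₂ : z ≠ b₂ := by rintro rfl; exact hzN hb₂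
  have hCm : ∀ t, t ∈ c.support ↔ t ∈ β.support ∨ t ∈ σ.support := fun t => by
    rw [hS.2, Walk.mem_support_append_iff]
  obtain ⟨p, hp⟩ := h3 b₁ b₂ z (by simp [hzb₁, hzb₂]) b₀ (by
    rintro (rfl | h)
    · exact hb₁.1 hb₀
    · rw [Set.mem_singleton_iff] at h
      exact hb₂.1 (h ▸ hb₀))
  obtain ⟨u, _, r, rfl, hu, hr⟩ := exists_last_mem (X := {t | t ∈ β.support}) p
    ⟨z, p.start_mem_support, hzβ⟩
  obtain ⟨w, r, r₂, rfl, hw, hr₁⟩ := exists_first_mem (X := {t | t ∈ σ.support ∨ t ∈ B}) r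
    ⟨b₀, r.end_mem_support, .inr hb₀⟩
  simp only [Walk.mem_support_append_iff, Set.mem_ofPred_eq] at hp hr hr₁ hu hw
  have hpr : ∀ t ∈ r.support, t ≠ b₁ ∧ t ≠ b₂ := fun t ht => by
    simpa using hp t (.inr (.inl ht))
  have hu12 := hpr u r.start_mem_support
  have hw12 := hpr w r.end_mem_support
  have hβσ : ∀ t, t ∈ β.support → t ∈ σ.support → t = b₂ ∨ t = b₁ := fun t => hC.eq_or_eq
  have huw : u ≠ w := by
    rintro rfl
    rcases hw with hw | hw
    · rcases hβσ u hu hw with rfl | rfl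
      exacts [hu12.2 rfl, hu12.1 rfl]
    · exact hB u ((hCm u).2 (.inl hu)) hw
  have hwσ : w ∈ σ.support := by
    refine hw.resolve_right fun hwB => ?_
    have hnil : ¬ r.Nil := fun h => huw h.eq
    have hadj := r.adj_penultimate hnil
    have hpen : r.penultimate ∈ r.support := r.getVert_mem_support _
    have hpB : r.penultimate ∉ B := fun h => hadj.ne (hr₁ _ hpen (.inr h))
    have hpN : r.penultimate ∈ extensions G B := ⟨hpB, .inr ⟨w, hwB, hadj⟩⟩
    rcases (hCm _).1 (hon _ hpN) with h | h
    · rcases hβ _ h hpN with h | h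
      exacts [(hpr _ hpen).1 h, (hpr _ hpen).2 h]
    · exact hadj.ne (hr₁ _ hpen (.inl h))
  have hPs : ∀ t ∈ r.bypass.reverse.support, t ∈ r.support := fun t ht => by
    rw [Walk.support_reverse, List.mem_reverse] at ht
    exact r.support_bypass_subset_support ht
  have hPlen : 1 ≤ r.bypass.reverse.length := by
    by_contra! h
    exact huw (Walk.eq_of_length_eq_zero (p := r.bypass.reverse) (by omega)).symm
  have hPpath : r.bypass.reverse.IsPath := r.bypass_isPath.reverse
  generalize r.bypass.reverse = P at hPs hPlen hPpath
  have hrB : ∀ t ∈ r.support, t ∉ B := fun t ht h =>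
    hB w ((hCm w).2 (.inr hwσ)) (hr₁ t ht (.inr h) ▸ h)
  obtain ⟨β₂, β₁, rfl⟩ : ∃ (β₂ : G.Walk b₂ u) (β₁ : G.Walk u b₁), β = β₂.append β₁ :=
    ⟨_, _, (β.take_spec hu).symm⟩
  obtain ⟨σ₁, σ₂, rfl⟩ : ∃ (σ₁ : G.Walk b₁ w) (σ₂ : G.Walk w b₂), σ = σ₁.append σ₂ :=
    ⟨_, _, (σ.take_spec hwσ).symm⟩
  have hcyc : Cyc ((β₁.append σ₁).append (σ₂.append β₂)) := by
    have h : Cyc (β₂.append (β₁.append (σ₁.append σ₂))) := by rwa [← Walk.append_assoc] at hC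
    have := h.swap
    simpa only [Walk.append_assoc] using this
  have hws : ws φ ((β₁.append σ₁).append (σ₂.append β₂)) = 1 := by
    rw [← h1, hS.1 φ hφ]; simp only [ws_append]; ring
  simp only [Walk.mem_support_append_iff] at hr hr₁ hu hCm
  have hPC : ∀ t ∈ P.support, t ∈ c.support → t = u ∨ t = w := by
    intro t ht htc
    rcases (hCm t).1 htc with h | h
    · exact .inl (hr t (.inl (hPs t ht)) h)
    · exact .inr (hr₁ t (hPs t ht) (.inl h))
  have hlen : ∀ {s t m : V} (q : G.Walk s m) (q' : G.Walk m t), s ≠ m → t ≠ m →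
      2 ≤ (q.append q').length := by
    intro s t m q q' h h'
    rw [Walk.length_append]
    have : q.length ≠ 0 := fun e => h (Walk.eq_of_length_eq_zero e)
    have : q'.length ≠ 0 := fun e => h' (Walk.eq_of_length_eq_zero e).symm
    omega
  have l1 := hlen β₁ σ₁ hu12.1 hw12.1
  have l2 := hlen σ₂ β₂ hw12.2 hu12.2
  rcases hcyc.theta_odd hφ hws huw hPpath
    (fun t ht h => hPC t ht ((hCm t).2 (by
      rw [Walk.mem_support_append_iff] at h; tauto)))
    (fun t ht h => hPC t ht ((hCm t).2 (by
      rw [Walk.mem_support_append_iff] at h; tauto))) (by omega) (by omega) with h | h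
  · refine hmax b₂ hb₂ ?_
    obtain ⟨y, d, hd, hd1, hdm⟩ := h
    refine ⟨y, d, hd, hd1, fun t ht => ?_⟩
    rintro (rfl | htB)
    · rcases hdm t ht with h | h
      · rcases hcyc.eq_or_eq h (by simp) with h | h
        exacts [hu12.2 h.symm, hw12.2 h.symm]
      · exact (hpr t (hPs t h)).2 rfl
    · rcases hdm t ht with h | h
      · exact hB t ((hCm t).2 (by rw [Walk.mem_support_append_iff] at h; tauto)) htB
      · exact hrB t (hPs t h) htB
  · refine hmax b₁ hb₁ ?_
    obtain ⟨y, d, hd, hd1, hdm⟩ := h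
    refine ⟨y, d, hd, hd1, fun t ht => ?_⟩
    rintro (rfl | htB)
    · rcases hdm t ht with h | h
      · rcases hcyc.eq_or_eq (by simp) h with h | h
        exacts [hu12.1 h.symm, hw12.1 h.symm]
      · exact (hpr t (hPs t h)).1 rfl
    · rcases hdm t ht with h | h
      · exact hB t ((hCm t).2 (by rw [Walk.mem_support_append_iff] at h; tauto)) htB
      · exact hrB t (hPs t h) htB

theorem Cyc.length_eq_one_of_adj {B : Set V} (hφ : ∀ x y, φ x y = φ y x)
    (hmax : ∀ b ∈ extensions G B, ¬ OddCyc G φ (insert b B)ᶜ) {x y : V} {α : G.Walk x y}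
    {β : G.Walk y x} (h : Cyc (α.append β)) (h1 : ws φ (α.append β) = 1)
    (hB : ∀ z ∈ (α.append β).support, z ∈ extensions G B) (hxy : G.Adj x y) :
    α.length = 1 ∨ β.length = 1 := by
  by_contra! hcon
  have hα0 : α.length ≠ 0 := fun e => hxy.ne (Walk.eq_of_length_eq_zero e)
  have hβ0 : β.length ≠ 0 := fun e => hxy.ne' (Walk.eq_of_length_eq_zero e)
  obtain ⟨a, ha, hax, hay⟩ := exists_inner (h.isPath_left hxy.ne) (by omega)
  obtain ⟨b, hb, hby, hbx⟩ := exists_inner (h.isPath_right hxy.ne) (by omega)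
  have hne : hxy.symm.toWalk.IsPath := by
    rw [Walk.isPath_def]; simp [hxy.ne']
  simp only [Walk.mem_support_append_iff] at hB
  rcases h.theta_odd hφ h1 hxy.ne hne (by simp) (by simp) (by simp; omega)
    (by simp; omega) with ⟨z, d, hd, hd1, hds⟩ | ⟨z, d, hd, hd1, hds⟩
  · refine hmax b (hB b (.inr hb)) ⟨z, d, hd, hd1, fun t ht => ?_⟩
    have htα : t ∈ α.support := by
      rcases hds t ht with h | h
      · exact h
      · simp only [Adj.toWalk, Walk.support_cons, Walk.support_nil, List.mem_cons,
          List.mem_nil_iff, or_false] at h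
        rcases h with rfl | rfl <;> simp
    rintro (rfl | htB)
    · rcases h.eq_or_eq htα hb with h | h <;> contradiction
    · exact (hB t (.inl htα)).1 htB
  · refine hmax a (hB a (.inl ha)) ⟨z, d, hd, hd1, fun t ht => ?_⟩
    have htβ : t ∈ β.support := by
      rcases hds t ht with h | h
      · exact h
      · simp only [Adj.toWalk, Walk.support_cons, Walk.support_nil, List.mem_cons,
          List.mem_nil_iff, or_false] at h
        rcases h with rfl | rfl <;> simp
    rintro (rfl | htB)
    · rcases h.eq_or_eq ha htβ with h | h <;> contradiction
    · exact (hB t (.inr htβ)).1 htB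

theorem snd_eq_of_length_eq_one {x y : V} {α : G.Walk x y} {β : G.Walk y x}
    (h : α.length = 1) : (α.append β).snd = y := by
  cases α with
  | nil => simp at h
  | cons a p =>
    cases p with
    | nil => simp
    | cons _ _ => simp at h

/-- Chordlessness from the fact that adjacent vertices are consecutive. -/
theorem Cyc.two_neighbors {u : V} {c : G.Walk u u} (hc : Cyc c)
    (h : ∀ (x y : V) (α : G.Walk x y) (β : G.Walk y x), Cyc (α.append β) →
      Same c (α.append β) → G.Adj x y → α.length = 1 ∨ β.length = 1) :
    ∀ x ∈ c.support, ∃ a b, ∀ y ∈ c.support, G.Adj x y → y = a ∨ y = b := by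
  classical
  intro x hx
  obtain ⟨d, hd, hs⟩ := hc.rotate hx
  refine ⟨d.snd, d.reverse.snd, fun y hy hxy => ?_⟩
  rw [hs.2] at hy
  have hsp := d.take_spec hy
  generalize d.takeUntil y hy = α at hsp
  generalize d.dropUntil y hy = β at hsp
  subst hsp
  rcases h x y α β hd hs hxy with h | h
  · exact .inl (snd_eq_of_length_eq_one h).symm
  · right
    rw [Walk.reverse_append]
    exact (snd_eq_of_length_eq_one (by simpa using h)).symm

theorem Cyc.split_three {u a b c : V} {d : G.Walk u u} (h : Cyc d) (ha : a ∈ d.support)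
    (hb : b ∈ d.support) (hc : c ∈ d.support) :
    (∃ (p : G.Walk a b) (q : G.Walk b c) (s : G.Walk c a),
      Cyc (p.append (q.append s)) ∧ Same d (p.append (q.append s))) ∨
    ∃ (p : G.Walk c b) (q : G.Walk b a) (s : G.Walk a c),
      Cyc (p.append (q.append s)) ∧ Same d (p.append (q.append s)) := by
  classical
  obtain ⟨α, β, hC, hS⟩ := h.split ha hb
  rw [hS.2, Walk.mem_support_append_iff] at hc
  rcases hc with hc | hc
  · right
    obtain ⟨α₁, α₂, rfl⟩ : ∃ (p : G.Walk a c) (q : G.Walk c b), α = p.append q :=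
      ⟨_, _, (α.take_spec hc).symm⟩
    have h1 : (α₁.append α₂).append β = α₁.append (α₂.append β) := (Walk.append_assoc _ _ _).symm
    rw [h1] at hC hS
    refine ⟨α₂, β, α₁, ?_, ?_⟩
    · rw [Walk.append_assoc]; exact hC.swap
    · rw [Walk.append_assoc]; exact hS.trans (same_swap _ _)
  · left
    obtain ⟨β₁, β₂, rfl⟩ : ∃ (p : G.Walk b c) (q : G.Walk c a), β = p.append q :=
      ⟨_, _, (β.take_spec hc).symm⟩
    exact ⟨α, β₁, β₂, hC, hS⟩

theorem compl_subset_of_maximal {B : Set V} (hφ : ∀ x y, φ x y = φ y x)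
    (hmax : ∀ b ∈ extensions G B, ¬ OddCyc G φ (insert b B)ᶜ) (h3 : ThreeConn G) {u : V}
    {d : G.Walk u u} (hd : Cyc d) (h1 : ws φ d = 1)
    (hN : ∀ z ∈ d.support, z ∈ extensions G B) : ∀ z, z ∉ d.support → z ∈ B := by
  by_contra! hcon
  obtain ⟨z, hzC, hzB⟩ := hcon
  have hon : ∀ b ∈ extensions G B, b ∈ d.support := by
    intro b hb
    by_contra hbc
    exact hmax b hb ⟨u, d, hd, h1, fun t ht => by
      rintro (rfl | h)
      exacts [hbc ht, (hN t ht).1 h]⟩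
  let Z := comp G {t | t ∉ d.support} z
  have hzZ : z ∈ Z := self_mem_comp hzC
  have hZC : ∀ t ∈ Z, t ∉ d.support := fun t ht => comp_subset ht
  have hZB : ∀ t ∈ Z, t ∉ B := by
    intro t ht htB
    obtain ⟨a, b, ha, haB, hb, hbB, hab⟩ := (Joined.symm ht).exit htB hzB
    exact hb (hon b ⟨hbB, .inr ⟨a, haB, hab.symm⟩⟩)
  have hatt : ∀ u w v, u ∈ d.support → w ∈ d.support → v ∈ d.support → v ≠ u → v ≠ w →
      ∃ a ∈ d.support, Touch G {a} Z ∧ a ≠ u ∧ a ≠ w := by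
    intro u w v hu hw hv hvu hvw
    obtain ⟨a, b, -, ha, hb, hbZ, hab⟩ := (h3 u w z (by
      rintro (rfl | rfl) <;> contradiction) v (by simp [hvu, hvw])).exit hzZ
        (fun h => hZC v h hv)
    refine ⟨b, ?_, ⟨b, rfl, a, ha, hab.symm⟩, ?_, ?_⟩
    · by_contra h
      exact hbZ (comp_closed ha h hab)
    · rintro rfl; exact hb (.inl rfl)
    · rintro rfl; exact hb (.inr rfl)
  -- an odd cycle inside the cycle and `Z` must contain every vertex of the cycle
  have hodd : ∀ T : Set V, OddCyc G φ T → (∀ t ∈ T, t ∈ d.support ∨ t ∈ Z) →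
      ∀ m ∈ d.support, m ∈ T := by
    rintro T ⟨y, e, he, he1, heT⟩ hT m hm
    by_contra hmT
    refine hmax m (hN m hm) ⟨y, e, he, he1, fun t ht => ?_⟩
    rintro (rfl | h)
    · exact hmT (heT t ht)
    · rcases hT t (heT t ht) with h' | h'
      exacts [(hN t h').1 h, hZB t h' h]
  have hpiece : ∀ (a b m : V) (p : G.Walk a b) (β : G.Walk b a), Cyc (p.append β) →
      Same d (p.append β) → a ≠ b → Touch G {a} Z → Touch G {b} Z → m ∈ β.support → m ≠ a →
      m ≠ b → p.length = 1 := by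
    intro a b m p β hC hS hab ha hb hm hma hmb
    by_contra hlen
    have hp0 : p.length ≠ 0 := fun e => hab (Walk.eq_of_length_eq_zero e)
    have hmem : ∀ t, t ∈ d.support ↔ t ∈ p.support ∨ t ∈ β.support := fun t => by
      rw [hS.2, Walk.mem_support_append_iff]
    obtain ⟨n, hn, hna, hnb⟩ := exists_inner (hC.isPath_left hab) (by omega)
    have haC : a ∈ d.support := (hmem a).2 (.inl p.start_mem_support)
    have hbC : b ∈ d.support := (hmem b).2 (.inl p.end_mem_support)
    obtain ⟨P, hP, hPl, hPs⟩ := exists_link (connOn_comp (G := G)) (fun h => hZC a h haC)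
      (fun h => hZC b h hbC) hab ha hb
    have hPC : ∀ t ∈ P.support, t ∈ d.support → t = a ∨ t = b := by
      intro t ht htc
      rcases hPs t ht with h | h | h
      exacts [.inl h, .inr h, absurd htc (hZC t h)]
    have hβ0 : β.length ≠ 0 := fun e => hab (Walk.eq_of_length_eq_zero e).symm
    rcases hC.theta_odd hφ (by rw [← h1, hS.1 φ hφ]) hab hP
      (fun t ht h => hPC t ht ((hmem t).2 (.inl h)))
      (fun t ht h => hPC t ht ((hmem t).2 (.inr h))) (by omega) (by omega) with h | h
    · rcases hodd _ h (fun t ht => ht.elim (fun h => .inl ((hmem t).2 (.inl h))) fun h => by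
        rcases hPs t h with rfl | rfl | h
        exacts [.inl haC, .inl hbC, .inr h]) m ((hmem m).2 (.inr hm)) with h | h
      · rcases hC.eq_or_eq h hm with h | h <;> contradiction
      · rcases hPC m h ((hmem m).2 (.inr hm)) with h | h <;> contradiction
    · rcases hodd _ h (fun t ht => ht.elim (fun h => .inl ((hmem t).2 (.inr h))) fun h => by
        rcases hPs t h with rfl | rfl | h
        exacts [.inl haC, .inl hbC, .inr h]) n ((hmem n).2 (.inl hn)) with h | h
      · rcases hC.eq_or_eq hn h with h | h <;> contradiction
      · rcases hPC n h ((hmem n).2 (.inl hn)) with h | h <;> contradiction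
  have htri : ∀ (a b c : V) (p : G.Walk a b) (q : G.Walk b c) (s : G.Walk c a),
      Cyc (p.append (q.append s)) → Same d (p.append (q.append s)) → a ≠ b → b ≠ c → c ≠ a →
      Touch G {a} Z → Touch G {b} Z → Touch G {c} Z → False := by
    intro a b c p q s hC hS hab hbc hca ha hb hc
    have hC2 : Cyc (q.append (s.append p)) := by
      rw [Walk.append_assoc]; exact hC.swap
    have hS2 : Same d (q.append (s.append p)) := by
      rw [Walk.append_assoc]; exact hS.trans (same_swap _ _)
    have hC3 : Cyc (s.append (p.append q)) := by
      rw [Walk.append_assoc]; exact hC2.swap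
    have hS3 : Same d (s.append (p.append q)) := by
      rw [Walk.append_assoc]; exact hS2.trans (same_swap _ _)
    have haC : a ∈ d.support := (hS.2 a).2 (Walk.start_mem_support _)
    have hbC : b ∈ d.support := (hS2.2 b).2 (Walk.start_mem_support _)
    have hcC : c ∈ d.support := (hS3.2 c).2 (Walk.start_mem_support _)
    have lp := hpiece a b c p _ hC hS hab ha hb (by simp) hca hbc.symm
    have lq := hpiece b c a q _ hC2 hS2 hbc hb hc (by simp) hab hca.symm
    have ls := hpiece c a b s _ hC3 hS3 hca hc ha (by simp) hbc hab.symm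
    have htot := (hS.1 φ hφ).symm.trans h1
    obtain ⟨_, ea, a', ha', haa'⟩ := ha
    obtain ⟨_, eb, b', hb', hbb'⟩ := hb
    obtain ⟨_, ec, c', hc', hcc'⟩ := hc
    rw [Set.mem_singleton_iff.1 ea] at haa'
    rw [Set.mem_singleton_iff.1 eb] at hbb'
    rw [Set.mem_singleton_iff.1 ec] at hcc'
    have hadj : ∀ {x y : V} (w : G.Walk x y), w.length = 1 → G.Adj x y ∧ ws φ w = φ x y := by
      intro x y w hw
      cases w with
      | nil => simp at hw
      | cons h w =>
        cases w with
        | nil => simp [h]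
        | cons _ _ => simp at hw
    simp only [ws_append] at htot
    rw [(hadj p lp).2, (hadj q lq).2, (hadj s ls).2] at htot
    have hcl : ∀ x y x' y' m : V, x ∈ d.support → y ∈ d.support → m ∈ d.support → m ≠ x →
        m ≠ y → G.Adj x x' → G.Adj y y' → G.Adj x y → ∀ w : G.Walk x' y',
        (∀ t ∈ w.support, t ∈ Z) → φ x x' + ws φ w + φ y y' + φ x y = 0 := by
      intro x y x' y' m hx hy hm hmx hmy hxx' hyy' hxy w hw
      have := ws_closed (G := G) (S := {t | t = x ∨ t = y ∨ t ∈ Z}) hφ (by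
        intro v e he heS
        rcases zmod_two_cases (ws φ e) with h | h
        · exact h
        · rcases hodd _ ⟨v, e, he, h, heS⟩ (by
            rintro t (rfl | rfl | h)
            exacts [.inl hx, .inl hy, .inr h]) m hm with rfl | rfl | h
          · contradiction
          · contradiction
          · exact absurd hm (hZC m h))
        (Walk.cons hxx' (w.append (.cons hyy'.symm (.cons hxy.symm .nil)))) (by
          intro t ht
          simp only [Walk.support_cons, Walk.mem_support_append_iff, List.mem_cons,
            Walk.support_nil, List.mem_nil_iff, or_false] at ht
          rcases ht with rfl | ht | rfl | rfl | rfl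
          · exact .inl rfl
          · exact .inr (.inr (hw t ht))
          · exact .inr (.inr (hw _ w.end_mem_support))
          · exact .inr (.inl rfl)
          · exact .inl rfl)
      simp only [ws_cons, ws_append, ws_nil] at this
      rw [← this, hφ y' y, hφ y x]
      ring
    obtain ⟨w₁, hw₁⟩ := connOn_comp (G := G) a' ha' b' hb'
    obtain ⟨w₂, hw₂⟩ := connOn_comp (G := G) b' hb' c' hc'
    have e1 := hcl a b a' b' c haC hbC hcC hca hbc.symm haa' hbb' (hadj p lp).1 w₁ hw₁
    have e2 := hcl b c b' c' a hbC hcC haC hab hca.symm hbb' hcc' (hadj q lq).1 w₂ hw₂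
    have e3 := hcl c a c' a' b hcC haC hbC hbc hab.symm hcc' haa' (hadj s ls).1
      (w₁.append w₂).reverse (by
        intro t ht
        rw [Walk.support_reverse, List.mem_reverse, Walk.mem_support_append_iff] at ht
        exact ht.elim (hw₁ t) (hw₂ t))
    rw [ws_reverse hφ, ws_append] at e3
    have : (1 : ZMod 2) = 0 := by
      linear_combination e1 + e2 + e3 - htot - (φ a a' + φ b b' + φ c c' + ws φ w₁ + ws φ w₂) *
        CharTwo.two_eq_zero (R := ZMod 2)
    exact one_ne_zero this
  obtain ⟨v, hv, hvu⟩ : ∃ v ∈ d.support, v ≠ u := by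
    cases d with
    | nil => simp [Cyc] at hd
    | @cons _ v _ a d => exact ⟨v, by simp, a.ne'⟩
  obtain ⟨v', hv', hvu', hvv'⟩ : ∃ v' ∈ d.support, v' ≠ u ∧ v' ≠ v := by
    obtain ⟨α, β, hC, hS⟩ := hd.split d.start_mem_support hv
    have hl := (cyc_append_iff.1 hC).1
    have : 2 ≤ α.length ∨ 2 ≤ β.length := by omega
    rcases this with h | h
    · obtain ⟨t, ht, h1, h2⟩ := exists_inner (hC.isPath_left hvu.symm) h
      exact ⟨t, (hS.2 t).2 (by simp [ht]), h1, h2⟩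
    · obtain ⟨t, ht, h1, h2⟩ := exists_inner (hC.isPath_right hvu.symm) h
      exact ⟨t, (hS.2 t).2 (by simp [ht]), h2, h1⟩
  have hthird : ∀ a b : V, ∃ c ∈ d.support, c ≠ a ∧ c ≠ b := by
    intro a b
    have hu := d.start_mem_support
    by_contra! hc
    have h1 := hc u hu
    have h2 := hc v hv
    have h3 := hc v' hv'
    clear * - h1 h2 h3 hvu hvu' hvv'
    by_cases e1 : u = a <;> by_cases e2 : v = a <;> by_cases e3 : v' = a <;> simp_all
  obtain ⟨t, ht, htu, -⟩ := hthird u u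
  obtain ⟨a, ha, haZ, -⟩ := hatt u u t d.start_mem_support d.start_mem_support ht htu htu
  obtain ⟨t, ht, hta, -⟩ := hthird a a
  obtain ⟨b, hb, hbZ, hba, -⟩ := hatt a a t ha ha ht hta hta
  obtain ⟨t, ht, hta, htb⟩ := hthird a b
  obtain ⟨c, hc, hcZ, hca, hcb⟩ := hatt a b t ha hb ht hta htb
  rcases hd.split_three ha hb hc with ⟨p, q, s, hC, hS⟩ | ⟨p, q, s, hC, hS⟩
  · exact htri a b c p q s hC hS hba.symm hcb.symm hca haZ hbZ hcZ
  · exact htri c b a p q s hC hS hcb hba hca.symm hcZ hbZ haZ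

/-- An odd cycle avoiding a connected set can be replaced by an odd peripheral cycle
avoiding it. -/
theorem exists_odd_peripheral [Finite V] (hφ : ∀ x y, φ x y = φ y x) (h3 : ThreeConn G)
    {B₀ : Set V} (hB₀ : ConnOn G B₀) (h : OddCyc G φ B₀ᶜ) :
    ∃ S, Peripheral G S ∧ Disjoint S B₀ ∧
      ∃ (x : V) (c : G.Walk x x), Cyc c ∧ ws φ c = 1 ∧ ∀ z, z ∈ c.support ↔ z ∈ S := by
  let 𝒞 : Set (Set V) := {B | ConnOn G B ∧ B₀ ⊆ B ∧ OddCyc G φ Bᶜ}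
  obtain ⟨B, ⟨hBc, hB₀B, x, c, hc, hc1, hcB⟩, hBmax⟩ :=
    (Set.toFinite 𝒞).exists_maximal ⟨B₀, hB₀, subset_rfl, h⟩
  have hmax : ∀ b ∈ extensions G B, ¬ OddCyc G φ (insert b B)ᶜ := by
    rintro b ⟨hbB, hb⟩ ho
    refine hbB (hBmax (y := insert b B) ⟨?_, hB₀B.trans (Set.subset_insert _ _), ho⟩
      (Set.subset_insert _ _) (Set.mem_insert _ _))
    rcases hb with rfl | ⟨a, ha, hba⟩
    · simpa using connOn_singleton b
    · exact hBc.insert ha hba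
  have hN := support_subset_extensions hφ hmax h3 hc hc1 hcB
  have hcompl := compl_subset_of_maximal hφ hmax h3 hc hc1 hN
  refine ⟨{z | z ∈ c.support}, ⟨⟨x, c, hc, fun _ => Iff.rfl⟩, ?_, ?_⟩, ?_,
    x, c, hc, hc1, fun _ => Iff.rfl⟩
  · refine hc.two_neighbors fun x y α β hC hS hxy => ?_
    exact hC.length_eq_one_of_adj hφ hmax (by rw [← hc1, hS.1 φ hφ])
      (fun z hz => hN z ((hS.2 z).2 hz)) hxy
  · have : {z | z ∈ c.support}ᶜ = B := by
      ext z
      exact ⟨hcompl z, fun hz hzc => hcB z hzc hz⟩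
    rwa [this]
  · rw [Set.disjoint_left]
    exact fun z hz hzB => hcB z hz (hB₀B hzB)

/-- A weight that is a coboundary on every peripheral cycle is a coboundary. -/
theorem exists_potential_of_peripheral [Finite V] (hφ : ∀ x y, φ x y = φ y x)
    (h3 : ThreeConn G) (hG : ConnOn G Set.univ)
    (h : ∀ S, Peripheral G S →
      ∃ p : V → ZMod 2, ∀ x ∈ S, ∀ y ∈ S, G.Adj x y → φ x y = p x + p y) :
    ∃ p : V → ZMod 2, ∀ x y, G.Adj x y → φ x y = p x + p y := by
  obtain ⟨p, hp⟩ := exists_potential hφ hG (by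
    intro x c hc _
    rcases zmod_two_cases (ws φ c) with h0 | h1
    · exact h0
    obtain ⟨S, hS, -, y, d, hd, hd1, hds⟩ :=
      exists_odd_peripheral hφ h3 connOn_empty ⟨x, c, hc, h1, by simp⟩
    obtain ⟨p, hp⟩ := h S hS
    rw [ws_eq_of_potential hp d fun z hz => (hds z).1 hz, CharTwo.add_self_eq_zero] at hd1
    exact absurd hd1 (by decide))
  exact ⟨p, fun x y => hp x trivial y trivial⟩

end

/-! ### An edge lies on exactly two peripheral cycles -/

section

variable {V : Type*} {G : SimpleGraph V}

/-- The inner vertices of a walk. -/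
def inner {x y : V} (p : G.Walk x y) : Set V := {z | z ∈ p.support ∧ z ≠ x ∧ z ≠ y}

theorem inner_reverse {x y : V} (p : G.Walk x y) : inner p.reverse = inner p := by
  ext z
  simp only [inner, Walk.support_reverse, List.mem_reverse, Set.mem_ofPred_eq]
  tauto

theorem two_le_length_of_inner {x y : V} {p : G.Walk x y} (h : (inner p).Nonempty) :
    2 ≤ p.length := by
  obtain ⟨z, hz, hzx, hzy⟩ := h
  cases p with
  | nil => simp_all
  | cons h p =>
    cases p with
    | nil => simp_all
    | cons _ _ => simp

theorem exists_inner_adj {x y : V} {p : G.Walk x y} (hp : p.IsPath) (hl : 2 ≤ p.length) :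
    ∃ z ∈ inner p, G.Adj x z := by
  cases p with
  | nil => simp at hl
  | @cons _ v _ h q =>
    cases q with
    | nil => simp at hl
    | cons h' q =>
      refine ⟨v, ⟨by simp, h.ne', ?_⟩, h⟩
      rintro rfl
      have := hp.of_cons
      rw [Walk.cons_isPath_iff] at this
      exact this.2 q.end_mem_support

theorem touch_inner {x y : V} {p : G.Walk x y} (hp : p.IsPath) (hl : 2 ≤ p.length) :
    Touch G {x} (inner p) ∧ Touch G {y} (inner p) := by
  constructor
  · obtain ⟨z, hz, h⟩ := exists_inner_adj hp hl
    exact ⟨x, rfl, z, hz, h⟩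
  · obtain ⟨z, hz, h⟩ := exists_inner_adj hp.reverse (by simpa using hl)
    rw [inner_reverse] at hz
    exact ⟨y, rfl, z, hz, h⟩

theorem connOn_support {x y : V} (p : G.Walk x y) : ConnOn G {z | z ∈ p.support} := by
  classical
  refine ConnOn.of_center (c := x) fun z hz => ⟨p.takeUntil z hz, fun w hw => ?_⟩
  exact p.support_takeUntil_subset_support hz hw

theorem connOn_support_diff_start {x y : V} {p : G.Walk x y} (hp : p.IsPath) :
    ConnOn G {z | z ∈ p.support ∧ z ≠ x} := by
  cases p with
  | nil =>
    convert connOn_empty (G := G)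
    ext z
    simp
  | cons h q =>
    convert connOn_support q using 1
    ext z
    rw [Walk.cons_isPath_iff] at hp
    simp only [Walk.support_cons, List.mem_cons, Set.mem_ofPred_eq]
    constructor
    · tauto
    · exact fun hz => ⟨.inr hz, by rintro rfl; exact hp.2 hz⟩

theorem connOn_inner {x y : V} {p : G.Walk x y} (hp : p.IsPath) : ConnOn G (inner p) := by
  cases p with
  | nil =>
    convert connOn_empty (G := G)
    ext z
    simp [inner]
  | cons h q =>
    rw [Walk.cons_isPath_iff] at hp
    convert connOn_support_diff_start hp.1.reverse using 1
    ext z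
    simp only [inner, Walk.support_cons, List.mem_cons, Set.mem_ofPred_eq, Walk.support_reverse,
      List.mem_reverse]
    constructor
    · tauto
    · exact fun hz => ⟨.inr hz.1, by rintro rfl; exact hp.2 hz.1, hz.2⟩

theorem blob_inner {x y : V} {p : G.Walk x y} (hp : p.IsPath) (hl : 2 ≤ p.length) :
    Blob G (inner p) :=
  let ⟨z, hz, _⟩ := exists_inner_adj hp hl
  ⟨⟨z, hz⟩, connOn_inner hp⟩

theorem exists_two_adj_of_inner {x y g : V} {p : G.Walk x y} (hp : p.IsPath)
    (hg : g ∈ inner p) :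
    ∃ a ∈ p.support, ∃ b ∈ p.support, a ≠ b ∧ G.Adj g a ∧ G.Adj g b := by
  classical
  obtain ⟨hg, hgx, hgy⟩ := hg
  obtain ⟨q, r, rfl⟩ : ∃ (q : G.Walk x g) (r : G.Walk g y), p = q.append r :=
    ⟨_, _, (p.take_spec hg).symm⟩
  have hq : ¬ q.Nil := fun h => hgx h.eq.symm
  have hr : ¬ r.Nil := fun h => hgy h.eq
  have h1 : q.penultimate ∈ q.support := q.getVert_mem_support _
  have h2 : r.snd ∈ r.support := r.getVert_mem_support _
  refine ⟨_, by simp [h1], r.snd, by simp [h2], ?_, (q.adj_penultimate hq).symm,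
    r.adj_snd hr⟩
  intro e
  rw [Walk.isPath_def, Walk.support_append, List.nodup_append] at hp
  refine hp.2.2 _ h1 _ (mem_tail_support h2 (r.adj_snd hr).ne') e

theorem Peripheral.adj_eq {S : Set V} (hS : Peripheral G S) {x a b c : V} (hx : x ∈ S)
    (ha : a ∈ S) (hb : b ∈ S) (hc : c ∈ S) (hxa : G.Adj x a) (hxb : G.Adj x b)
    (hxc : G.Adj x c) (hab : a ≠ b) : c = a ∨ c = b := by
  obtain ⟨s, t, h⟩ := hS.2.1 x hx
  have h1 := h a ha hxa
  have h2 := h b hb hxb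
  have h3 := h c hc hxc
  clear * - h1 h2 h3 hab
  rcases h1 with rfl | rfl <;> rcases h2 with rfl | rfl <;> tauto

theorem Peripheral.split {S : Set V} (hS : Peripheral G S) {x y : V} (hx : x ∈ S)
    (hy : y ∈ S) : ∃ (α : G.Walk x y) (β : G.Walk y x), Cyc (α.append β) ∧
      ∀ z, z ∈ S ↔ z ∈ α.support ∨ z ∈ β.support := by
  obtain ⟨u, c, hc, hcS⟩ := hS.1
  obtain ⟨α, β, h, hs⟩ := hc.split ((hcS x).2 hx) ((hcS y).2 hy)
  exact ⟨α, β, h, fun z => by rw [← hcS, hs.2, Walk.mem_support_append_iff]⟩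

theorem Peripheral.length_eq_one {S : Set V} (hS : Peripheral G S) {x y : V} (hxy : G.Adj x y)
    {α : G.Walk x y} {β : G.Walk y x} (h : Cyc (α.append β))
    (hm : ∀ z, z ∈ S ↔ z ∈ α.support ∨ z ∈ β.support) : α.length = 1 ∨ β.length = 1 := by
  by_contra! hcon
  have hα0 : α.length ≠ 0 := fun e => hxy.ne (Walk.eq_of_length_eq_zero e)
  have hβ0 : β.length ≠ 0 := fun e => hxy.ne' (Walk.eq_of_length_eq_zero e)
  obtain ⟨a, ha, hxa⟩ := exists_inner_adj (h.isPath_left hxy.ne) (by omega)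
  obtain ⟨b, hb, hxb⟩ := exists_inner_adj (h.isPath_right hxy.ne).reverse (by simp; omega)
  rw [inner_reverse] at hb
  have hab : a ≠ b := by
    rintro rfl
    rcases h.eq_or_eq ha.1 hb.1 with e | e
    exacts [ha.2.1 e, ha.2.2 e]
  rcases hS.adj_eq ((hm x).2 (by simp)) ((hm a).2 (.inl ha.1)) ((hm b).2 (.inr hb.1))
    ((hm y).2 (by simp)) hxa hxb hxy hab with e | e
  exacts [ha.2.2 e.symm, hb.2.1 e.symm]

theorem Cyc.exists_two_adj {u x : V} {c : G.Walk u u} (hc : Cyc c) (hx : x ∈ c.support) :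
    ∃ a ∈ c.support, ∃ b ∈ c.support, a ≠ b ∧ G.Adj x a ∧ G.Adj x b := by
  obtain ⟨d, hd, hs⟩ := hc.rotate hx
  cases d with
  | nil => simp [Cyc] at hd
  | @cons _ v _ h q =>
    have hq : q.IsPath := by
      rw [Walk.isPath_def]
      simpa using hd.2
    obtain ⟨b, hb, hxb⟩ := exists_inner_adj hq.reverse (by have := hd.1; simp at this ⊢; omega)
    rw [inner_reverse] at hb
    exact ⟨v, (hs.2 v).2 (by simp), b, (hs.2 b).2 (by simp [hb.1]), hb.2.1.symm, h, hxb⟩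

theorem Peripheral.connOn {S : Set V} (hS : Peripheral G S) : ConnOn G S := by
  obtain ⟨u, c, hc, hcS⟩ := hS.1
  have : S = {z | z ∈ c.support} := by ext z; exact (hcS z).symm
  rw [this]
  exact connOn_support c

theorem Peripheral.eq_of_subset {S S' : Set V} (hS : Peripheral G S) (hS' : Peripheral G S')
    (h : S ⊆ S') : S = S' := by
  refine h.antisymm fun y hy => ?_
  by_contra hyS
  obtain ⟨u, c, hc, hcS⟩ := hS.1
  have hu : u ∈ S := (hcS u).1 c.start_mem_support
  obtain ⟨a, b, ha, haS, hb, hbS, hab⟩ := (hS'.connOn u (h hu) y hy).exit hu hyS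
  obtain ⟨s, hs, t, ht, hst, has, hat⟩ := hc.exists_two_adj ((hcS a).2 haS)
  rcases hS'.adj_eq ha (h ((hcS s).1 hs)) (h ((hcS t).1 ht)) hb has hat hab hst with rfl | rfl
  exacts [hbS ((hcS b).1 hs), hbS ((hcS b).1 ht)]

theorem comp_eq {S : Set V} {x y : V} (h : y ∈ comp G S x) : comp G S y = comp G S x := by
  ext z
  exact ⟨fun hz => Joined.trans h hz, fun hz => (Joined.symm h).trans hz⟩

/-- A connected set covered by `W`, `A` and `A'` links `A` to `A'`, directly or through a
component of `W`. -/
theorem exists_linking_comp {T W A A' : Set V} (hT : ConnOn G T) (hTW : T ⊆ W ∪ A ∪ A')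
    {s t : V} (hs : s ∈ T) (hsA : s ∈ A ∨ s ∈ W ∧ Touch G (comp G W s) A) (ht : t ∈ T)
    (htA' : t ∉ A) (htW : t ∉ W) :
    Touch G A A' ∨ ∃ x ∈ W, Touch G (comp G W x) A ∧ Touch G (comp G W x) A' := by
  obtain ⟨a, b, ha, haA, hb, hbA, hab⟩ := (hT s hs t ht).exit
    (A := A ∪ {x | x ∈ W ∧ Touch G (comp G W x) A}) hsA (by
      rintro (h | h)
      exacts [htA' h, htW h.1])
  have hbA1 : b ∉ A := fun h => hbA (.inl h)
  have hbW : b ∉ W := by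
    intro h
    refine hbA (.inr ⟨h, ?_⟩)
    rcases haA with haA | ⟨haW, haT⟩
    · exact ⟨b, self_mem_comp h, a, haA, hab.symm⟩
    · rwa [comp_eq (comp_closed (self_mem_comp haW) h hab)]
  have hbA' : b ∈ A' := by
    rcases hTW hb with (h | h) | h
    exacts [absurd h hbW, absurd h hbA1, h]
  rcases haA with haA | ⟨haW, haT⟩
  · exact .inl ⟨a, haA, b, hbA', hab⟩
  · exact .inr ⟨a, haW, haT, a, self_mem_comp haW, b, hbA', hab⟩

theorem ThreeConn.exists_adj (h3 : ThreeConn G)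
    (h4 : ∀ a b c : V, ∃ d, d ≠ a ∧ d ≠ b ∧ d ≠ c) {x a b : V} (hxa : x ≠ a) (hxb : x ≠ b) :
    ∃ y, G.Adj x y ∧ y ≠ a ∧ y ≠ b := by
  obtain ⟨d, hdx, hda, hdb⟩ := h4 x a b
  obtain ⟨x', y, -, rfl, hy, -, hxy⟩ := (h3 a b x (by simp [hxa, hxb]) d
    (by simp [hda, hdb])).exit (A := {x}) rfl (by simpa using hdx)
  exact ⟨y, hxy, by simpa using hy⟩

/-- Configuration used to exclude two peripheral cycles that cross: `E` is an ear of the cycle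
`S₁` contained in `S₂`. -/
theorem arc_subset_of_ear [Finite V] (hG : Planar G) (h3 : ThreeConn G)
    (h4 : ∀ a b c : V, ∃ d, d ≠ a ∧ d ≠ b ∧ d ≠ c) {S₁ S₂ E : Set V}
    (hS₁ : Peripheral G S₁) (hS₂ : Peripheral G S₂) {b₁ b₂ : V} (hb : b₁ ≠ b₂) (hb₁ : b₁ ∈ S₂)
    (hb₂ : b₂ ∈ S₂) (hE : Blob G E) (hES₁ : Disjoint E S₁) (hES₂ : E ⊆ S₂)
    (hE₁ : Touch G {b₁} E) (hE₂ : Touch G {b₂} E) {γ : G.Walk b₁ b₂} {γ' : G.Walk b₂ b₁}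
    (hC : Cyc (γ.append γ')) (hm : ∀ z, z ∈ S₁ ↔ z ∈ γ.support ∨ z ∈ γ'.support)
    (hl : 2 ≤ γ.length) (hl' : 2 ≤ γ'.length) : inner γ' ⊆ S₂ := by
  intro t ht
  by_contra htS
  have hp := hC.isPath_left hb
  have hp' := hC.isPath_right hb
  have hdis : ∀ z ∈ inner γ, z ∉ γ'.support := fun z hz h => by
    rcases hC.eq_or_eq hz.1 h with e | e
    exacts [hz.2.1 e, hz.2.2 e]
  have hdis' : ∀ z ∈ inner γ', z ∉ γ.support := fun z hz h => by
    rcases hC.eq_or_eq h hz.1 with e | e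
    exacts [hz.2.2 e, hz.2.1 e]
  have hS₁γ : inner γ ⊆ S₁ := fun z hz => (hm z).2 (.inl hz.1)
  have hS₁γ' : inner γ' ⊆ S₁ := fun z hz => (hm z).2 (.inr hz.1)
  have hnadj : ¬ Touch G (inner γ) (inner γ') := by
    rintro ⟨g, hg, g', hg', hadj⟩
    obtain ⟨a, ha, b, hb, hab, hga, hgb⟩ := exists_two_adj_of_inner hp hg
    rcases hS₁.adj_eq (hS₁γ hg) ((hm a).2 (.inl ha)) ((hm b).2 (.inl hb)) (hS₁γ' hg') hga hgb
      hadj hab with rfl | rfl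
    exacts [hdis' _ hg' ha, hdis' _ hg' hb]
  let W : Set V := (S₁ ∪ S₂)ᶜ
  obtain ⟨s, hs, hsA⟩ : ∃ s ∈ S₂ᶜ, s ∈ inner γ ∨ s ∈ W ∧ Touch G (comp G W s) (inner γ) := by
    obtain ⟨w, hw, hbw⟩ := exists_inner_adj hp hl
    by_cases hwS : w ∈ S₂
    · by_cases hsub : inner γ ⊆ S₂
      · obtain ⟨a, ha, b, hb', hab, hwa, hwb⟩ := exists_two_adj_of_inner hp hw
        have hγS : ∀ z ∈ γ.support, z ∈ S₂ := by
          intro z hz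
          by_cases e1 : z = b₁
          · exact e1 ▸ hb₁
          by_cases e2 : z = b₂
          · exact e2 ▸ hb₂
          exact hsub ⟨hz, e1, e2⟩
        obtain ⟨z, hwz, hza, hzb⟩ := h3.exists_adj h4 hwa.ne hwb.ne
        have hz1 : z ∉ S₁ := fun h => by
          rcases hS₁.adj_eq (hS₁γ hw) ((hm a).2 (.inl ha)) ((hm b).2 (.inl hb')) h hwa hwb hwz
            hab with e | e
          exacts [hza e, hzb e]
        have hz2 : z ∉ S₂ := fun h => by
          rcases hS₂.adj_eq hwS (hγS a ha) (hγS b hb') h hwa hwb hwz hab with e | e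
          exacts [hza e, hzb e]
        have hzW : z ∈ W := by rintro (h | h) <;> contradiction
        exact ⟨z, hz2, .inr ⟨hzW, z, self_mem_comp hzW, w, hw, hwz.symm⟩⟩
      · obtain ⟨s, hs, hs2⟩ := Set.not_subset.1 hsub
        exact ⟨s, hs2, .inl hs⟩
    · exact ⟨w, hwS, .inl hw⟩
  rcases exists_linking_comp (A := inner γ) (A' := inner γ') hS₂.2.2 (W := W) (by
    intro z hz
    by_cases hz1 : z ∈ S₁
    · have h1 : z ≠ b₁ := by rintro rfl; exact hz hb₁
      have h2 : z ≠ b₂ := by rintro rfl; exact hz hb₂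
      rcases (hm z).1 hz1 with h | h
      · exact .inl (.inr ⟨h, h1, h2⟩)
      · exact .inr ⟨h, h2, h1⟩
    · refine .inl (.inl ?_)
      rintro (h | h) <;> contradiction) hs hsA htS (fun h => hdis' t ht h.1)
    (fun h => h (.inl (hS₁γ' ht))) with h | ⟨x, hxW, hxγ, hxγ'⟩
  · exact hnadj h
  have hWS₁ : ∀ z ∈ W, z ∉ S₁ := fun z hz h => hz (.inl h)
  have hx1 : x ∉ S₁ := hWS₁ x hxW
  have hWU : W ⊆ (S₁ ∪ E)ᶜ := by
    rintro z hz (h | h)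
    exacts [hz (.inl h), hz (.inr (hES₂ h))]
  have hxU := hWU hxW
  let M := comp G (S₁ ∪ E)ᶜ x
  have hLM : comp G W x ⊆ M := fun z hz => Joined.mono hz hWU
  have hM1 : ∀ z ∈ M, z ∉ S₁ := fun z hz h => comp_subset hz (.inl h)
  have hME : ∀ z ∈ M, z ∉ E := fun z hz h => comp_subset hz (.inr h)
  have hMtE : Touch G M E := by
    obtain ⟨e, he⟩ := hE.1
    obtain ⟨a, b, ha, haM, hb, hbM, hab⟩ := (hS₁.2.2 x hx1 e
      (Set.disjoint_left.1 hES₁ he)).exit (A := M) (self_mem_comp hxU) (fun h => hME e h he)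
    refine ⟨a, haM, b, ?_, hab⟩
    by_contra hbE
    exact hbM (comp_closed haM (by rintro (h | h) <;> contradiction) hab)
  have hb₁S : b₁ ∈ S₁ := (hm b₁).2 (by simp)
  have hb₂S : b₂ ∈ S₁ := (hm b₂).2 (by simp)
  have tγ := touch_inner hp hl
  have tγ' := touch_inner hp' hl'
  refine not_K33 hG (blob_singleton b₁) (blob_singleton b₂)
    (⟨⟨x, self_mem_comp hxU⟩, connOn_comp⟩ : Blob G M)
    (blob_inner hp hl) (blob_inner hp' hl') hE ⟨?_, ?_, ?_⟩ ⟨?_, ?_, ?_⟩ ⟨?_, ?_, ?_⟩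
    ⟨?_, ?_, ?_⟩ ⟨?_, ?_, ?_⟩ ⟨tγ.1, tγ'.2, hE₁⟩ ⟨tγ.2, tγ'.1, hE₂⟩
    ⟨hxγ.mono hLM subset_rfl, hxγ'.mono hLM subset_rfl, hMtE⟩
  · simpa using hb
  · rw [Set.disjoint_singleton_left]; exact fun h => hM1 _ h hb₁S
  · rw [Set.disjoint_singleton_left]; exact fun h => hM1 _ h hb₂S
  · rw [Set.disjoint_left]; exact fun z hz h => hdis z hz h.1
  · rw [Set.disjoint_right]; exact fun z hz h => Set.disjoint_left.1 hES₁ hz (hS₁γ h)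
  · rw [Set.disjoint_right]; exact fun z hz h => Set.disjoint_left.1 hES₁ hz (hS₁γ' h)
  · rw [Set.disjoint_singleton_left]; exact fun h => h.2.1 rfl
  · rw [Set.disjoint_singleton_left]; exact fun h => h.2.2 rfl
  · rw [Set.disjoint_singleton_left]; exact fun h => Set.disjoint_left.1 hES₁ h hb₁S
  · rw [Set.disjoint_singleton_left]; exact fun h => h.2.2 rfl
  · rw [Set.disjoint_singleton_left]; exact fun h => h.2.1 rfl
  · rw [Set.disjoint_singleton_left]; exact fun h => Set.disjoint_left.1 hES₁ h hb₂S
  · rw [Set.disjoint_left]; exact fun z hz h => hM1 z hz (hS₁γ h)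
  · rw [Set.disjoint_left]; exact fun z hz h => hM1 z hz (hS₁γ' h)
  · rw [Set.disjoint_left]; exact fun z hz h => hME z hz h

theorem exists_adj_of_length_eq_one {x y : V} {p : G.Walk x y} (h : p.length = 1) :
    G.Adj x y ∧ ∀ z ∈ p.support, z = x ∨ z = y := by
  cases p with
  | nil => simp at h
  | cons a p =>
    cases p with
    | nil => simpa using a
    | cons _ _ => simp at h

/-- Two distinct peripheral cycles through a common pair of vertices meet only there. -/
theorem Peripheral.inter_subset [Finite V] (hG : Planar G) (h3 : ThreeConn G)
    (h4 : ∀ a b c : V, ∃ d, d ≠ a ∧ d ≠ b ∧ d ≠ c) {S₁ S₂ : Set V}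
    (hS₁ : Peripheral G S₁) (hS₂ : Peripheral G S₂) (hne : S₁ ≠ S₂) {u v : V} (huv : u ≠ v)
    (hu₁ : u ∈ S₁) (hv₁ : v ∈ S₁) (hu₂ : u ∈ S₂) (hv₂ : v ∈ S₂) :
    ∀ z ∈ S₁, z ∈ S₂ → z = u ∨ z = v := by
  obtain ⟨y, hy₂, hy₁⟩ : ∃ y ∈ S₂, y ∉ S₁ := by
    by_contra! h
    exact hne (hS₂.eq_of_subset hS₁ h).symm
  obtain ⟨o, c, hc, hcS⟩ := hS₂.1
  obtain ⟨b₁, b₂, β, σ, hb, hb₁, hb₂, hC, hs, hyβ, hβ⟩ := hc.segment ((hcS y).2 hy₂) hy₁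
    ⟨u, (hcS u).2 hu₂, v, (hcS v).2 hv₂, huv, hu₁, hv₁⟩
  have hm₂ : ∀ z, z ∈ S₂ ↔ z ∈ β.support ∨ z ∈ σ.support := fun z => by
    rw [← hcS, hs.2, Walk.mem_support_append_iff]
  have hβp := hC.isPath_left hb.symm
  have hyE : y ∈ inner β := ⟨hyβ, by rintro rfl; contradiction, by rintro rfl; contradiction⟩
  have hβl := two_le_length_of_inner ⟨y, hyE⟩
  have hES₁ : Disjoint (inner β) S₁ := Set.disjoint_left.2 fun z hz h => by
    rcases hβ z hz.1 h with e | e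
    exacts [hz.2.2 e, hz.2.1 e]
  have hES₂ : inner β ⊆ S₂ := fun z hz => (hm₂ z).2 (.inl hz.1)
  have tE := touch_inner hβp hβl
  have hb₁₂ : b₁ ∈ S₂ := (hm₂ b₁).2 (by simp)
  have hb₂₂ : b₂ ∈ S₂ := (hm₂ b₂).2 (by simp)
  obtain ⟨γ, γ', hC₁, hm₁⟩ := hS₁.split hb₁ hb₂
  have hadj : G.Adj b₁ b₂ := by
    by_contra hnadj
    have h0 : γ.length ≠ 0 := fun e => hb (Walk.eq_of_length_eq_zero e)
    have h0' : γ'.length ≠ 0 := fun e => hb (Walk.eq_of_length_eq_zero e).symm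
    have h1 : γ.length ≠ 1 := fun e => hnadj (exists_adj_of_length_eq_one e).1
    have h1' : γ'.length ≠ 1 := fun e => hnadj (exists_adj_of_length_eq_one e).1.symm
    have i1 := arc_subset_of_ear hG h3 h4 hS₁ hS₂ hb hb₁₂ hb₂₂ (blob_inner hβp hβl) hES₁ hES₂
      tE.2 tE.1 hC₁ hm₁ (by omega) (by omega)
    have i2 := arc_subset_of_ear hG h3 h4 hS₁ hS₂ hb.symm hb₂₂ hb₁₂ (blob_inner hβp hβl) hES₁
      hES₂ tE.1 tE.2 hC₁.swap (fun z => (hm₁ z).trans or_comm) (by omega) (by omega)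
    refine hne (hS₁.eq_of_subset hS₂ fun z hz => ?_)
    by_cases e1 : z = b₁
    · exact e1 ▸ hb₁₂
    by_cases e2 : z = b₂
    · exact e2 ▸ hb₂₂
    rcases (hm₁ z).1 hz with h | h
    exacts [i2 ⟨h, e1, e2⟩, i1 ⟨h, e2, e1⟩]
  have hσ : σ.length = 1 := (hS₂.length_eq_one hadj.symm hC hm₂).resolve_left (by omega)
  have key : ∀ z ∈ S₁, z ∈ S₂ → z = b₁ ∨ z = b₂ := by
    intro z h1 h2
    rcases (hm₂ z).1 h2 with h | h
    exacts [hβ z h h1, (exists_adj_of_length_eq_one hσ).2 z h]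
  intro z h1 h2
  have k1 := key z h1 h2
  have k2 := key u hu₁ hu₂
  have k3 := key v hv₁ hv₂
  clear * - k1 k2 k3 huv hb
  grind

theorem Peripheral.blob_diff {S : Set V} (hS : Peripheral G S) {u v : V} (huv : G.Adj u v)
    (hu : u ∈ S) (hv : v ∈ S) :
    Blob G (S \ {u, v}) ∧ Touch G {u} (S \ {u, v}) ∧ Touch G {v} (S \ {u, v}) := by
  obtain ⟨α, β, hC, hm⟩ := hS.split hu hv
  have hl := (cyc_append_iff.1 hC).1
  rcases hS.length_eq_one huv hC hm with h | h
  · have e : S \ {u, v} = inner β := by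
      ext z
      have := (exists_adj_of_length_eq_one h).2 z
      simp only [Set.mem_sdiff, hm, Set.mem_insert_iff, Set.mem_singleton_iff, inner,
        Set.mem_ofPred_eq]
      tauto
    rw [e]
    have hp := hC.isPath_right huv.ne
    exact ⟨blob_inner hp (by omega), (touch_inner hp (by omega)).symm⟩
  · have e : S \ {u, v} = inner α := by
      ext z
      have := (exists_adj_of_length_eq_one h).2 z
      simp only [Set.mem_sdiff, hm, Set.mem_insert_iff, Set.mem_singleton_iff, inner,
        Set.mem_ofPred_eq]
      tauto
    rw [e]
    have hp := hC.isPath_left huv.ne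
    exact ⟨blob_inner hp (by omega), touch_inner hp (by omega)⟩

theorem exists_link_set {T W A A' : Set V} (hT : ConnOn G T) (hTW : T ⊆ W ∪ A ∪ A')
    (hA : Blob G A) (hA' : Blob G A') (hAT : A ⊆ T) (hAT' : A' ⊆ T) (hAA : Disjoint A A')
    (hAW : Disjoint A' W) :
    ∃ L ⊆ W, (∀ x ∈ L, L = comp G W x) ∧ (L.Nonempty → Touch G L A ∧ Touch G L A') ∧
      Blob G (A ∪ L) ∧ Touch G (A ∪ L) A' := by
  obtain ⟨s, hs⟩ := hA.1
  obtain ⟨t, ht⟩ := hA'.1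
  rcases exists_linking_comp hT hTW (hAT hs) (.inl hs) (hAT' ht)
    (Set.disjoint_right.1 hAA ht) (Set.disjoint_left.1 hAW ht) with h | ⟨x, hx, h1, h2⟩
  · exact ⟨∅, by simp, by simp, by simp, by simpa using hA, by simpa using h⟩
  · exact ⟨comp G W x, comp_subset, fun y hy => (comp_eq hy).symm, fun _ => ⟨h1, h2⟩,
      ⟨hA.1.mono Set.subset_union_left, hA.2.union connOn_comp h1.symm⟩,
      h2.mono Set.subset_union_right le_rfl⟩

/-- An edge of a 3-connected planar graph lies on at most two peripheral cycles. -/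
theorem Peripheral.not_three [Finite V] (hG : Planar G) (h3 : ThreeConn G)
    (h4 : ∀ a b c : V, ∃ d, d ≠ a ∧ d ≠ b ∧ d ≠ c) {S₁ S₂ S₃ : Set V}
    (hS₁ : Peripheral G S₁) (hS₂ : Peripheral G S₂) (hS₃ : Peripheral G S₃) (h₁₂ : S₁ ≠ S₂)
    (h₁₃ : S₁ ≠ S₃) (h₂₃ : S₂ ≠ S₃) {u v : V} (huv : G.Adj u v)
    (hu₁ : u ∈ S₁) (hv₁ : v ∈ S₁) (hu₂ : u ∈ S₂) (hv₂ : v ∈ S₂) (hu₃ : u ∈ S₃) (hv₃ : v ∈ S₃) :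
    False := by
  have i₁₂ := hS₁.inter_subset hG h3 h4 hS₂ h₁₂ huv.ne hu₁ hv₁ hu₂ hv₂
  have i₁₃ := hS₁.inter_subset hG h3 h4 hS₃ h₁₃ huv.ne hu₁ hv₁ hu₃ hv₃
  have i₂₃ := hS₂.inter_subset hG h3 h4 hS₃ h₂₃ huv.ne hu₂ hv₂ hu₃ hv₃
  have dd : ∀ {S S' : Set V}, (∀ z ∈ S, z ∈ S' → z = u ∨ z = v) →
      Disjoint (S \ {u, v}) S' := fun h =>
    Set.disjoint_left.2 fun z hz hz' => hz.2 (h z hz.1 hz')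
  have dd' : ∀ {S S' : Set V}, (∀ z ∈ S, z ∈ S' → z = u ∨ z = v) →
      Disjoint (S' \ {u, v}) S := fun h =>
    Set.disjoint_left.2 fun z hz hz' => hz.2 (h z hz' hz.1)
  obtain ⟨b₁, tu₁, tv₁⟩ := hS₁.blob_diff huv hu₁ hv₁
  obtain ⟨b₂, tu₂, tv₂⟩ := hS₂.blob_diff huv hu₂ hv₂
  obtain ⟨b₃, tu₃, tv₃⟩ := hS₃.blob_diff huv hu₃ hv₃
  have e₁₂ := dd i₁₂; have e₁₃ := dd i₁₃; have e₂₃ := dd i₂₃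
  have e₂₁ := dd' i₁₂; have e₃₁ := dd' i₁₃; have e₃₂ := dd' i₂₃
  have sub : ∀ S : Set V, S \ {u, v} ⊆ S := fun S => Set.sdiff_subset
  have nu : ∀ S : Set V, u ∉ S \ {u, v} := fun S h => h.2 (.inl rfl)
  have nv : ∀ S : Set V, v ∉ S \ {u, v} := fun S h => h.2 (.inr rfl)
  have cover : ∀ z, z ≠ u → z ≠ v → z ∉ (S₁ ∪ S₂ ∪ S₃)ᶜ →
      z ∈ S₁ \ {u, v} ∨ z ∈ S₂ \ {u, v} ∨ z ∈ S₃ \ {u, v} := by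
    intro z h1 h2 h
    have : z ∉ ({u, v} : Set V) := by simp [h1, h2]
    rcases not_not.1 h with (h | h) | h
    exacts [.inl ⟨h, this⟩, .inr (.inl ⟨h, this⟩), .inr (.inr ⟨h, this⟩)]
  have w₁ : Disjoint (S₁ \ {u, v}) (S₁ ∪ S₂ ∪ S₃)ᶜ :=
    Set.disjoint_left.2 fun z h h' => h' (.inl (.inl h.1))
  have w₂ : Disjoint (S₂ \ {u, v}) (S₁ ∪ S₂ ∪ S₃)ᶜ :=
    Set.disjoint_left.2 fun z h h' => h' (.inl (.inr h.1))
  have w₃ : Disjoint (S₃ \ {u, v}) (S₁ ∪ S₂ ∪ S₃)ᶜ :=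
    Set.disjoint_left.2 fun z h h' => h' (.inr h.1)
  have wu : u ∉ (S₁ ∪ S₂ ∪ S₃)ᶜ := fun h => h (.inr hu₃)
  have wv : v ∉ (S₁ ∪ S₂ ∪ S₃)ᶜ := fun h => h (.inr hv₃)
  generalize hW : (S₁ ∪ S₂ ∪ S₃)ᶜ = W at *
  have c₁ : S₁ᶜ ⊆ W ∪ S₂ \ {u, v} ∪ S₃ \ {u, v} := fun z hz => by
    by_cases h : z ∈ W
    · exact .inl (.inl h)
    rcases cover z (fun e => hz (e ▸ hu₁)) (fun e => hz (e ▸ hv₁)) h with h | h | h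
    exacts [absurd h.1 hz, .inl (.inr h), .inr h]
  have c₂ : S₂ᶜ ⊆ W ∪ S₃ \ {u, v} ∪ S₁ \ {u, v} := fun z hz => by
    by_cases h : z ∈ W
    · exact .inl (.inl h)
    rcases cover z (fun e => hz (e ▸ hu₂)) (fun e => hz (e ▸ hv₂)) h with h | h | h
    exacts [.inr h, absurd h.1 hz, .inl (.inr h)]
  have c₃ : S₃ᶜ ⊆ W ∪ S₁ \ {u, v} ∪ S₂ \ {u, v} := fun z hz => by
    by_cases h : z ∈ W
    · exact .inl (.inl h)
    rcases cover z (fun e => hz (e ▸ hu₃)) (fun e => hz (e ▸ hv₃)) h with h | h | h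
    exacts [.inl (.inr h), .inr h, absurd h.1 hz]
  have k₁₂ := e₁₂.mono_right (sub S₂)
  have k₁₃ := e₁₃.mono_right (sub S₃)
  have k₂₃ := e₂₃.mono_right (sub S₃)
  obtain ⟨L₁, l₁, m₁, n₁, p₁, q₁⟩ := exists_link_set hS₃.2.2 c₃ b₁ b₂
    e₁₃.subset_compl_right e₂₃.subset_compl_right k₁₂ w₂
  obtain ⟨L₂, l₂, m₂, n₂, p₂, q₂⟩ := exists_link_set hS₁.2.2 c₁ b₂ b₃
    e₂₁.subset_compl_right e₃₁.subset_compl_right k₂₃ w₃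
  obtain ⟨L₃, l₃, m₃, n₃, p₃, q₃⟩ := exists_link_set hS₂.2.2 c₂ b₃ b₁
    e₃₂.subset_compl_right e₁₂.subset_compl_right k₁₃.symm w₁
  have k33 : ∀ x ∈ W, Touch G (comp G W x) (S₁ \ {u, v}) → Touch G (comp G W x) (S₂ \ {u, v}) →
      Touch G (comp G W x) (S₃ \ {u, v}) → False := by
    intro x hx t1 t2 t3
    have hc : comp G W x ⊆ W := comp_subset
    exact not_K33 hG (blob_singleton u) (blob_singleton v)
      ⟨⟨x, self_mem_comp hx⟩, connOn_comp⟩ b₁ b₂ b₃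
      (by simpa using ⟨huv.ne, fun h => wu (hc h), fun h => wv (hc h)⟩)
      ⟨k₁₂, k₁₃, k₂₃⟩ (by simp) (by simp)
      ⟨w₁.symm.mono_left hc, w₂.symm.mono_left hc, w₃.symm.mono_left hc⟩
      ⟨tu₁, tu₂, tu₃⟩ ⟨tv₁, tv₂, tv₃⟩ ⟨t1, t2, t3⟩
  have f₁₂ : Disjoint L₁ L₂ := Set.disjoint_left.2 fun x h h' => by
    have t := n₁ ⟨x, h⟩
    have t' := n₂ ⟨x, h'⟩
    rw [m₁ x h] at t
    rw [m₂ x h'] at t'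
    exact k33 x (l₁ h) t.1 t.2 t'.2
  have f₁₃ : Disjoint L₁ L₃ := Set.disjoint_left.2 fun x h h' => by
    have t := n₁ ⟨x, h⟩
    have t' := n₃ ⟨x, h'⟩
    rw [m₁ x h] at t
    rw [m₃ x h'] at t'
    exact k33 x (l₁ h) t.1 t.2 t'.1
  have f₂₃ : Disjoint L₂ L₃ := Set.disjoint_left.2 fun x h h' => by
    have t := n₂ ⟨x, h⟩
    have t' := n₃ ⟨x, h'⟩
    rw [m₂ x h] at t
    rw [m₃ x h'] at t'
    exact k33 x (l₂ h) t'.2 t.1 t.2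
  have un : ∀ {A B L L' : Set V}, Disjoint A B → Disjoint A W → Disjoint B W → L ⊆ W → L' ⊆ W →
      Disjoint L L' → Disjoint (A ∪ L) (B ∪ L') := fun h h1 h2 h3 h4 h5 => by
    simp only [Set.disjoint_union_left, Set.disjoint_union_right]
    exact ⟨⟨h, (h2.mono_right h3).symm⟩, h1.mono_right h4, h5⟩
  have ul : ∀ A L : Set V, A ⊆ A ∪ L := fun _ _ => Set.subset_union_left
  have du : ∀ {S L : Set V}, L ⊆ W → Disjoint {u} (S \ {u, v} ∪ L) := fun h => by
    simpa using fun h' => wu (h h')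
  have dv : ∀ {S L : Set V}, L ⊆ W → Disjoint {v} (S \ {u, v} ∪ L) := fun h => by
    simpa using fun h' => wv (h h')
  exact not_K5 hG (blob_singleton u) (blob_singleton v) p₁ p₂ p₃
    ⟨by simpa using huv.ne, du l₁, du l₂, du l₃⟩ ⟨dv l₁, dv l₂, dv l₃⟩
    ⟨un k₁₂ w₁ w₂ l₁ l₂ f₁₂, un k₁₃ w₁ w₃ l₁ l₃ f₁₃⟩ (un k₂₃ w₂ w₃ l₂ l₃ f₂₃)
    ⟨⟨u, rfl, v, rfl, huv⟩, tu₁.mono le_rfl (ul _ _), tu₂.mono le_rfl (ul _ _),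
      tu₃.mono le_rfl (ul _ _)⟩
    ⟨tv₁.mono le_rfl (ul _ _), tv₂.mono le_rfl (ul _ _), tv₃.mono le_rfl (ul _ _)⟩
    ⟨q₁.mono le_rfl (ul _ _), q₃.symm.mono (ul _ _) le_rfl⟩ (q₂.mono le_rfl (ul _ _))

theorem ws_edge_eq_zero {u v : V} [DecidableEq V] {x y : V} (p : G.Walk x y)
    (h : u ∉ p.support ∨ v ∉ p.support) :
    ws (fun a b => if s(a, b) = s(u, v) then 1 else 0) p = 0 := by
  induction p with
  | nil => simp
  | @cons a b c hab q ih =>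
    have : s(a, b) ≠ s(u, v) := by
      intro e
      rcases Sym2.eq_iff.1 e with ⟨rfl, rfl⟩ | ⟨rfl, rfl⟩ <;> simp at h
    rw [ws_cons, ih (by simp at h; tauto), if_neg this, add_zero]

theorem exists_peripheral_of_adj [Finite V] (h3 : ThreeConn G)
    (h4 : ∀ a b c : V, ∃ d, d ≠ a ∧ d ≠ b ∧ d ≠ c) {u v z : V} (huv : G.Adj u v) (hz : z ≠ u)
    (hzv : z ≠ v) {B : Set V} (hB : B ⊆ {z}) (hBc : ConnOn G B) :
    ∃ S, Peripheral G S ∧ u ∈ S ∧ v ∈ S ∧ Disjoint S B := by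
  classical
  set φ : V → V → ZMod 2 := fun a b => if s(a, b) = s(u, v) then 1 else 0 with hφd
  have hφ : ∀ x y, φ x y = φ y x := fun x y => by
    simp only [hφd]
    rw [Sym2.eq_swap]
  obtain ⟨u', hu', hu'v, hu'z⟩ := h3.exists_adj h4 huv.ne hz.symm
  obtain ⟨p, hp⟩ := h3 u z v (by simp [huv.ne', hzv.symm]) u' (by simp [hu'.ne', hu'z])
  have hpb : ∀ y ∈ p.bypass.support, y ≠ u ∧ y ≠ z := fun y hy => by
    simpa using hp y (p.support_bypass_subset_support hy)
  have hu : u ∉ p.bypass.support := fun h => (hpb u h).1 rfl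
  have hc : Cyc (Walk.cons huv (p.bypass.concat hu'.symm)) := by
    constructor
    · have : p.bypass.length ≠ 0 := fun e => hu'v (Walk.eq_of_length_eq_zero e).symm
      simp only [Walk.length_cons, Walk.length_concat]
      omega
    · simp only [Walk.support_cons, List.tail_cons, Walk.support_concat]
      rw [List.nodup_append]
      exact ⟨p.bypass_isPath.support_nodup, by simp, by
        rintro a ha b hb rfl
        simp only [List.mem_singleton] at hb
        exact hu (hb ▸ ha)⟩
  have hodd : ws φ (Walk.cons huv (p.bypass.concat hu'.symm)) = 1 := by
    have h1 : ws φ p.bypass = 0 := ws_edge_eq_zero _ (.inl hu)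
    have h2 : φ u' u = 0 := by
      simp only [hφd]
      rw [if_neg]
      intro e
      rcases Sym2.eq_iff.1 e with ⟨e, -⟩ | ⟨e, -⟩
      exacts [hu'.ne' e, hu'v e]
    have h3 : φ u v = 1 := by simp [hφd]
    rw [ws_cons, Walk.concat, ws_append, ws_cons, ws_nil, h1, h2, h3]
    simp
  obtain ⟨S, hS, hd, x, c, hcc, hw, hm⟩ := exists_odd_peripheral hφ h3 hBc
    ⟨u, _, hc, hodd, fun y hy hyB => by
      have := hB hyB
      simp only [Walk.support_cons, Walk.support_concat, List.mem_cons, List.mem_append,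
        List.mem_nil_iff, or_false] at hy
      rcases hy with rfl | hy | rfl
      exacts [hz this.symm, (hpb y hy).2 this, hz this.symm]⟩
  have : u ∈ c.support ∧ v ∈ c.support := by
    by_contra h
    rw [ws_edge_eq_zero c (by tauto)] at hw
    exact zero_ne_one hw
  exact ⟨S, hS, (hm u).1 this.1, (hm v).1 this.2, hd⟩

/-- An edge of a 3-connected planar graph lies on exactly two peripheral cycles. -/
theorem exists_two_peripheral [Finite V] (hG : Planar G) (h3 : ThreeConn G)
    (h4 : ∀ a b c : V, ∃ d, d ≠ a ∧ d ≠ b ∧ d ≠ c) {u v : V} (huv : G.Adj u v) :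
    ∃ S₁ S₂, Peripheral G S₁ ∧ Peripheral G S₂ ∧ S₁ ≠ S₂ ∧ u ∈ S₁ ∧ v ∈ S₁ ∧ u ∈ S₂ ∧ v ∈ S₂ ∧
      ∀ S, Peripheral G S → u ∈ S → v ∈ S → S = S₁ ∨ S = S₂ := by
  obtain ⟨z₀, hz₀, hz₀', -⟩ := h4 u v u
  obtain ⟨S₁, hS₁, hu₁, hv₁, -⟩ := exists_peripheral_of_adj h3 h4 huv hz₀ hz₀' (by simp)
    connOn_empty
  obtain ⟨z, hz, hzuv⟩ := (hS₁.blob_diff huv hu₁ hv₁).1.1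
  have hz' : z ≠ u ∧ z ≠ v := by simpa using hzuv
  obtain ⟨S₂, hS₂, hu₂, hv₂, hd⟩ := exists_peripheral_of_adj h3 h4 huv hz'.1 hz'.2 le_rfl
    (connOn_singleton z)
  have hne : S₁ ≠ S₂ := by
    rintro rfl
    exact Set.disjoint_left.1 hd hz rfl
  refine ⟨S₁, S₂, hS₁, hS₂, hne, hu₁, hv₁, hu₂, hv₂, fun S hS hu hv => ?_⟩
  by_contra! h
  exact hS₁.not_three hG h3 h4 hS₂ hS hne h.1.symm h.2.symm huv hu₁ hv₁ hu₂ hv₂ hu hv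

end

/-! ### Triangulations and tree-cotree decompositions -/

section

variable {W N : Type*} {H : SimpleGraph W} {inc : N → Finset (Sym2 W)} {o : W} {par : W → W}
  {d : W → ℕ}

/-- `inc` lists the edges of the triangles of a triangulation of the sphere with 1-skeleton `H`. -/
structure Triangulation (H : SimpleGraph W) (inc : N → Finset (Sym2 W)) : Prop where
  mem_edgeSet : ∀ t, ∀ e ∈ inc t, e ∈ H.edgeSet
  exists_triangle : ∀ t, ∃ a b c, a ≠ b ∧ b ≠ c ∧ a ≠ c ∧
    ∀ e, e ∈ inc t ↔ e = s(a, b) ∨ e = s(b, c) ∨ e = s(a, c)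
  exists_two : ∀ e ∈ H.edgeSet, ∃ t t', t ≠ t' ∧ ∀ s, e ∈ inc s ↔ s = t ∨ s = t'
  exists_potential : ∀ φ : Sym2 W → ZMod 2, (∀ t, ∑ e ∈ inc t, φ e = 0) →
    ∃ p : W → ZMod 2, ∀ x y, H.Adj x y → φ s(x, y) = p x + p y
  connOn : ∀ w, ConnOn H {w}ᶜ
  exists_adj : ∀ w, ∃ x, H.Adj w x

/-- `par` is the parent function of a spanning tree of `H` rooted at `o`. -/
structure IsParent (H : SimpleGraph W) (o : W) (par : W → W) (d : W → ℕ) : Prop where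
  root : par o = o
  adj : ∀ x, x ≠ o → H.Adj x (par x)
  lt : ∀ x, x ≠ o → d (par x) < d x

/-- `a` is an ancestor of `x`. -/
def Anc (par : W → W) (a x : W) : Prop := ∃ k, par^[k] x = a

theorem Anc.refl (x : W) : Anc par x x := ⟨0, rfl⟩

theorem Anc.trans {x y z : W} (h : Anc par x y) (h' : Anc par y z) : Anc par x z := by
  obtain ⟨k, rfl⟩ := h
  obtain ⟨l, rfl⟩ := h'
  exact ⟨k + l, Function.iterate_add_apply _ _ _ _⟩

theorem anc_par (x : W) : Anc par (par x) x := ⟨1, rfl⟩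

theorem Anc.eq_or {a x : W} (h : Anc par a x) : a = x ∨ Anc par a (par x) := by
  obtain ⟨k, rfl⟩ := h
  cases k with
  | zero => exact .inl rfl
  | succ k => exact .inr ⟨k, rfl⟩

theorem Anc.mem {U : Set W} (hU : ∀ x ∈ U, par x ∈ U) {a x : W} (h : Anc par a x) (hx : x ∈ U) :
    a ∈ U := by
  obtain ⟨k, rfl⟩ := h
  induction k with
  | zero => exact hx
  | succ k ih => exact Function.iterate_succ_apply' par k x ▸ hU _ ih

namespace IsParent

theorem induct (hp : IsParent H o par d) {a : W} {P : W → Prop} (h0 : P a)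
    (h : ∀ x, x ≠ a → x ≠ o → Anc par a (par x) → P (par x) → P x) {x : W} (hx : Anc par a x) :
    P x := by
  obtain ⟨k, hk⟩ := hx
  induction k generalizing x with
  | zero =>
    obtain rfl : x = a := hk
    exact h0
  | succ k ih =>
    by_cases hxa : x = a
    · exact hxa ▸ h0
    by_cases hxo : x = o
    · rw [hxo, Function.iterate_fixed hp.root] at hk
      exact absurd (hxo.trans hk) hxa
    exact h x hxa hxo ⟨k, hk⟩ (ih hk)

theorem anc_root (hp : IsParent H o par d) (x : W) : Anc par o x := by
  induction hn : d x using Nat.strong_induction_on generalizing x with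
  | _ n ih =>
    by_cases hx : x = o
    · exact hx ▸ .refl _
    · exact (ih _ (hn ▸ hp.lt x hx) _ rfl).trans (anc_par x)

theorem le_of_anc (hp : IsParent H o par d) {a x : W} (h : Anc par a x) : d a ≤ d x :=
  hp.induct (P := fun y => d a ≤ d y) le_rfl (fun y _ ho _ ih => ih.trans (hp.lt y ho).le) h

end IsParent

/-- The edges of `H` outside the spanning tree. -/
def Cotree (H : SimpleGraph W) (o : W) (par : W → W) (e : Sym2 W) : Prop :=
  e ∈ H.edgeSet ∧ ∀ x, x ≠ o → e ≠ s(x, par x)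

/-- Triangles sharing an edge outside the spanning tree are adjacent. -/
def dual (H : SimpleGraph W) (inc : N → Finset (Sym2 W)) (o : W) (par : W → W) :
    SimpleGraph N where
  Adj t s := t ≠ s ∧ ∃ e, Cotree H o par e ∧ e ∈ inc t ∧ e ∈ inc s
  symm := ⟨fun _ _ h => ⟨h.1.symm, h.2.imp fun _ h => ⟨h.1, h.2.2, h.2.1⟩⟩⟩
  loopless := ⟨fun _ h => h.1 rfl⟩

theorem Triangulation.exists_sum_eq (hT : Triangulation H inc) (t : N) :
    ∃ a b c, (a ≠ b ∧ b ≠ c ∧ a ≠ c) ∧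
      (∀ e, e ∈ inc t ↔ e = s(a, b) ∨ e = s(b, c) ∨ e = s(a, c)) ∧
      ∀ φ : Sym2 W → ZMod 2, ∑ e ∈ inc t, φ e = φ s(a, b) + φ s(b, c) + φ s(a, c) := by
  classical
  obtain ⟨a, b, c, hab, hbc, hac, h⟩ := hT.exists_triangle t
  refine ⟨a, b, c, ⟨hab, hbc, hac⟩, h, fun φ => ?_⟩
  have : inc t = {s(a, b), s(b, c), s(a, c)} := by
    ext e
    simp [h]
  rw [this, Finset.sum_insert, Finset.sum_pair, add_assoc] <;> simp_all [Ne.symm]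

theorem Triangulation.eq_zero (hT : Triangulation H inc) (hp : IsParent H o par d)
    {φ : Sym2 W → ZMod 2} (hφ : ∀ t, ∑ e ∈ inc t, φ e = 0) (h : ∀ e, ¬Cotree H o par e → φ e = 0)
    (e : Sym2 W) : φ e = 0 := by
  obtain ⟨p, hpp⟩ := hT.exists_potential φ hφ
  have hc : ∀ x, p x = p o := fun x =>
    hp.induct (P := fun x => p x = p o) rfl (fun y _ ho _ ih => by
      have := hpp _ _ (hp.adj y ho)
      rw [h _ fun hc => hc.2 y ho rfl] at this
      rw [← ih, CharTwo.add_eq_zero.1 this.symm]) (hp.anc_root x)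
  by_cases he : Cotree H o par e
  · induction e using Sym2.ind with
    | _ x y => rw [hpp x y he.1, hc, hc y, CharTwo.add_self_eq_zero]
  · exact h e he

theorem Triangulation.sum_indicator [DecidableEq W] [DecidableEq N] (hT : Triangulation H inc)
    {e : Sym2 W} (he : e ∈ H.edgeSet)
    {t s : N} (ht : e ∈ inc t) (hs : e ∈ inc s) (hts : t ≠ s) (r : N) :
    ∑ f ∈ inc r, (if f = e then (1 : ZMod 2) else 0)
      = (if r = t then 1 else 0) + if r = s then 1 else 0 := by
  obtain ⟨a, b, hab, h⟩ := hT.exists_two e he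
  rw [Finset.sum_ite_eq']
  have h1 := (h t).1 ht
  have h2 := (h s).1 hs
  have h3 := h r
  by_cases r = t <;> by_cases r = s <;> rcases h1 with rfl | rfl <;>
    rcases h2 with rfl | rfl <;> simp_all

theorem Triangulation.cotree_unique (hT : Triangulation H inc) (hp : IsParent H o par d)
    {e f : Sym2 W} (he : Cotree H o par e) (hf : Cotree H o par f) {t s : N} (hts : t ≠ s)
    (het : e ∈ inc t) (hes : e ∈ inc s) (hft : f ∈ inc t) (hfs : f ∈ inc s) : e = f := by
  classical
  by_contra hne
  have := hT.eq_zero hp (φ := fun g => (if g = e then 1 else 0) + if g = f then 1 else 0)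
    (fun r => by
      rw [Finset.sum_add_distrib, hT.sum_indicator he.1 het hes hts,
        hT.sum_indicator hf.1 hft hfs hts, CharTwo.add_self_eq_zero])
    (fun g hg => by
      rw [if_neg (by rintro rfl; exact hg he), if_neg (by rintro rfl; exact hg hf), add_zero]) e
  simp [hne] at this

theorem Triangulation.isAcyclic_dual (hT : Triangulation H inc) (hp : IsParent H o par d) :
    (dual H inc o par).IsAcyclic := by
  classical
  rw [isAcyclic_iff_forall_adj_isBridge]
  rintro t t' ⟨hne, e, he, het, het'⟩
  rw [isBridge_iff]
  rintro ⟨p⟩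
  have key : ∀ {s s' : N} (q : (dual H inc o par \ fromEdgeSet {s(t, t')}).Walk s s'),
      ∃ φ : Sym2 W → ZMod 2, φ e = 0 ∧ (∀ f, ¬Cotree H o par f → φ f = 0) ∧
        ∀ r, ∑ f ∈ inc r, φ f = (if r = s then 1 else 0) + if r = s' then 1 else 0 := by
    intro s s' q
    induction q with
    | nil => exact ⟨0, rfl, fun _ _ => rfl, fun r => by simp [CharTwo.add_self_eq_zero]⟩
    | @cons x y z hxy q ih =>
      obtain ⟨φ, h1, h2, h3⟩ := ih
      obtain ⟨⟨hne', f, hf, hfx, hfy⟩, hxy'⟩ := hxy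
      have hfe : e ≠ f := by
        rintro rfl
        obtain ⟨a, b, hab, h⟩ := hT.exists_two e he.1
        refine hxy' ⟨?_, hne'⟩
        rcases (h t).1 het with rfl | rfl <;> rcases (h t').1 het' with rfl | rfl <;>
          rcases (h x).1 hfx with rfl | rfl <;> rcases (h y).1 hfy with rfl | rfl <;>
            simp_all [Sym2.eq_swap]
      refine ⟨fun g => (if g = f then 1 else 0) + φ g, by simp [hfe, h1], fun g hg => ?_,
        fun r => ?_⟩
      · beta_reduce
        rw [h2 g hg, if_neg (by rintro rfl; exact hg hf), add_zero]
      · rw [Finset.sum_add_distrib, h3, hT.sum_indicator hf.1 hfx hfy hne', ← add_assoc,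
          add_assoc (ite (r = x) _ _), CharTwo.add_self_eq_zero, add_zero]
  obtain ⟨φ, h1, h2, h3⟩ := key p
  have := hT.eq_zero hp (φ := fun g => (if g = e then 1 else 0) + φ g)
    (fun r => by
      rw [Finset.sum_add_distrib, hT.sum_indicator he.1 het het' hne, h3,
        CharTwo.add_self_eq_zero])
    (fun g hg => by
      rw [if_neg (by rintro rfl; exact hg he), h2 g hg, add_zero]) e
  simp [h1] at this

namespace Triangulation

theorem sum_eq_zero_iff [Fintype N] [DecidableEq W] (hT : Triangulation H inc) {e : Sym2 W}
    (he : e ∈ H.edgeSet) (σ : N → ZMod 2) :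
    (∑ t, if e ∈ inc t then σ t else 0) = 0 ↔
      ∀ t s, e ∈ inc t → e ∈ inc s → σ t = σ s := by
  classical
  obtain ⟨a, b, hab, h⟩ := hT.exists_two e he
  have : (∑ t, if e ∈ inc t then σ t else 0) = σ a + σ b := by
    rw [← Finset.sum_filter, ← Finset.sum_pair hab]
    exact Finset.sum_congr (by ext; simp [h]) fun _ _ => rfl
  rw [this, CharTwo.add_eq_zero]
  constructor
  · intro e t s ht hs
    rcases (h t).1 ht with rfl | rfl <;> rcases (h s).1 hs with rfl | rfl <;> simp [e]
  · exact fun h' => h' a b ((h a).2 (.inl rfl)) ((h b).2 (.inr rfl))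

theorem side_eq_of_par [Finite N] [Finite W] (hT : Triangulation H inc)
    (hp : IsParent H o par d) {σ : N → ZMod 2} {U : Set W} (hU : ∀ x ∈ U, par x ∈ U)
    (h : ∀ e, Cotree H o par e → (∃ x ∈ e, x ∉ U) → ∀ t s, e ∈ inc t → e ∈ inc s → σ t = σ s)
    {w : W} (hw : w ∉ U) (hwo : w ≠ o) :
    ∀ t s, s(w, par w) ∈ inc t → s(w, par w) ∈ inc s → σ t = σ s := by
  classical
  have := Fintype.ofFinite N
  have := Fintype.ofFinite W
  set z : W → ZMod 2 := fun x => if Anc par w x then 1 else 0 with hz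
  have z1 : ∀ x, Anc par w x → z x = 1 := fun x hx => if_pos hx
  have z0 : ∀ x, ¬Anc par w x → z x = 0 := fun x hx => if_neg hx
  let δ : Sym2 W → ZMod 2 := Sym2.lift ⟨fun a b => z a + z b, fun a b => add_comm _ _⟩
  have hδ : ∀ a b, δ s(a, b) = z a + z b := fun _ _ => rfl
  have hδ0 : ∀ t, ∑ e ∈ inc t, δ e = 0 := fun t => by
    obtain ⟨a, b, c, -, -, hs⟩ := hT.exists_sum_eq t
    rw [hs, hδ, hδ, hδ]
    have h1 : z a + z b + (z b + z c) + (z a + z c)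
      = (z a + z a) + (z b + z b) + (z c + z c) := by ring
    rw [h1]
    simp [CharTwo.add_self_eq_zero]
  have hUa : ∀ x, Anc par w x → x ∉ U := fun x h hx => hw (h.mem hU hx)
  have hsum : ∑ e, δ e * ∑ t, (if e ∈ inc t then σ t else 0) = 0 := by
    have : ∑ t, σ t * ∑ e, (if e ∈ inc t then δ e else 0) = 0 :=
      Finset.sum_eq_zero fun t _ => by
        rw [← Finset.sum_filter, Finset.filter_univ_mem, hδ0, mul_zero]
    refine Eq.trans ?_ this
    simp_rw [Finset.mul_sum]
    rw [Finset.sum_comm]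
    refine Finset.sum_congr rfl fun t _ => Finset.sum_congr rfl fun e _ => ?_
    split_ifs
    · ring
    · simp
  have hadj := hp.adj w hwo
  rw [← hT.sum_eq_zero_iff hadj σ]
  rw [Finset.sum_eq_single s(w, par w)] at hsum
  · rwa [hδ, z1 w (.refl w), z0 (par w) fun h' => (hp.lt w hwo).not_ge (hp.le_of_anc h'), add_zero,
      one_mul] at hsum
  · intro e _ hne
    by_cases he : e ∈ H.edgeSet
    · by_cases hc : Cotree H o par e
      · by_cases hx : ∃ x ∈ e, x ∉ U
        · rw [(hT.sum_eq_zero_iff he σ).2 (h e hc hx), mul_zero]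
        · push Not at hx
          induction e using Sym2.ind with
          | _ a b =>
            rw [hδ, z0 a fun h' => hUa a h' (hx a (by simp)),
              z0 b fun h' => hUa b h' (hx b (by simp))]
            simp
      · obtain ⟨x, hxo, rfl⟩ : ∃ x, x ≠ o ∧ e = s(x, par x) := by
          by_contra! hh
          exact hc ⟨he, hh⟩
        have : z x = z (par x) := by
          by_cases hx : Anc par w x
          · rcases hx.eq_or with rfl | hx'
            · exact absurd rfl hne
            · rw [z1 x hx, z1 _ hx']
          · rw [z0 x hx, z0 _ fun h' => hx (h'.trans (anc_par x))]
        rw [hδ, this, CharTwo.add_self_eq_zero, zero_mul]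
    · rw [Finset.sum_eq_zero, mul_zero]
      exact fun t _ => if_neg fun ht => he (hT.mem_edgeSet t e ht)
  · exact fun h => absurd (Finset.mem_univ _) h

theorem side_eq [Finite N] [Finite W] (hT : Triangulation H inc)
    (hp : IsParent H o par d) {σ : N → ZMod 2} {U : Set W} (hU : ∀ x ∈ U, par x ∈ U)
    (h : ∀ e, Cotree H o par e → (∃ x ∈ e, x ∉ U) → ∀ t s, e ∈ inc t → e ∈ inc s → σ t = σ s)
    {w : W} (hw : w ∉ U) {t s : N} {e f : Sym2 W} (het : e ∈ inc t) (hwe : w ∈ e)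
    (hfs : f ∈ inc s) (hwf : w ∈ f) : σ t = σ s := by
  classical
  have key : ∀ e, w ∈ e → ∀ t s, e ∈ inc t → e ∈ inc s → σ t = σ s := by
    intro e hwe t s ht hs
    have he := hT.mem_edgeSet t e ht
    by_cases hc : Cotree H o par e
    · exact h e hc ⟨w, hwe, hw⟩ t s ht hs
    · obtain ⟨x, hxo, rfl⟩ : ∃ x, x ≠ o ∧ e = s(x, par x) := by
        by_contra! hh
        exact hc ⟨he, hh⟩
      refine hT.side_eq_of_par hp hU h (fun hx => hw ?_) hxo t s ht hs
      rcases Sym2.mem_iff.1 hwe with rfl | rfl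
      exacts [hx, hU x hx]
  set φ : Sym2 W → ZMod 2 := fun e => if w ∈ e ∧ ∃ t, e ∈ inc t ∧ σ t = 1 then 1 else 0 with hφ
  have φ0 : ∀ e, w ∉ e → φ e = 0 := fun e he => if_neg fun h => he h.1
  have φ1 : ∀ e t, w ∈ e → e ∈ inc t → φ e = σ t := by
    intro e t he ht
    simp only [hφ]
    split_ifs with h'
    · obtain ⟨-, s, hs, h1⟩ := h'
      rw [← h1, key e he s t hs ht]
    · rcases zmod_two_cases (σ t) with h0 | h1
      exacts [h0.symm, absurd ⟨he, t, ht, h1⟩ h']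
  obtain ⟨p, hpp⟩ := hT.exists_potential φ fun t => by
    obtain ⟨a, b, c, ⟨hab, hbc, hac⟩, hm, hs⟩ := hT.exists_sum_eq t
    have m1 := (hm s(a, b)).2 (by simp)
    have m2 := (hm s(b, c)).2 (by simp)
    have m3 := (hm s(a, c)).2 (by simp)
    rw [hs]
    by_cases ha : w = a
    · rw [φ1 _ t (by simp [ha]) m1, φ0 s(b, c) (by simp [ha, hab, hac]),
        φ1 _ t (by simp [ha]) m3, add_zero, CharTwo.add_self_eq_zero]
    by_cases hb : w = b
    · rw [φ1 _ t (by simp [hb]) m1, φ1 _ t (by simp [hb]) m2,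
        φ0 s(a, c) (by simp [hb, hab.symm, hbc]), add_zero, CharTwo.add_self_eq_zero]
    by_cases hc : w = c
    · rw [φ0 s(a, b) (by simp [hc, hac.symm, hbc.symm]), φ1 _ t (by simp [hc]) m2,
        φ1 _ t (by simp [hc]) m3, zero_add, CharTwo.add_self_eq_zero]
    rw [φ0 _ (by simp [ha, hb]), φ0 _ (by simp [hb, hc]), φ0 _ (by simp [ha, hc])]
    simp
  have hconst : ∀ x y, x ≠ w → y ≠ w → p x = p y := by
    intro x y hx hy
    obtain ⟨q, hq⟩ := hT.connOn w x hx y hy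
    induction q with
    | nil => rfl
    | @cons a b c hab q ih =>
      have hb : b ≠ w := hq b (by simp)
      have := hpp a b hab
      rw [φ0 _ (by simp [hx.symm, hb.symm])] at this
      rw [CharTwo.add_eq_zero.1 this.symm]
      exact ih hb hy fun z hz => hq z (by simp [hz])
  have hval : ∀ e t, w ∈ e → e ∈ inc t → ∃ x, x ≠ w ∧ σ t = p w + p x := by
    intro e t he ht
    obtain ⟨x, rfl⟩ := he
    have hadj : H.Adj w x := hT.mem_edgeSet t _ ht
    exact ⟨x, hadj.ne', by rw [← φ1 _ t (by simp) ht, hpp w x hadj]⟩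
  obtain ⟨x, hx, h1⟩ := hval e t hwe het
  obtain ⟨y, hy, h2⟩ := hval f s hwf hfs
  rw [h1, h2, hconst x y hx hy]

theorem exists_mem (hT : Triangulation H inc) {x y : W} (h : H.Adj x y) : ∃ t, s(x, y) ∈ inc t := by
  obtain ⟨t, t', -, h'⟩ := hT.exists_two s(x, y) h
  exact ⟨t, (h' t).2 (.inl rfl)⟩

theorem side_eq_of_anc [Finite N] [Finite W] (hT : Triangulation H inc)
    (hp : IsParent H o par d) {σ : N → ZMod 2} {U : Set W} (hU : ∀ x ∈ U, par x ∈ U)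
    (h : ∀ e, Cotree H o par e → (∃ x ∈ e, x ∉ U) → ∀ t s, e ∈ inc t → e ∈ inc s → σ t = σ s)
    {a : W} (ha : a ∉ U) {x y : W} (hx : Anc par a x) (hy : Anc par a y) {t s : N}
    (ht : ∃ e ∈ inc t, x ∈ e) (hs : ∃ e ∈ inc s, y ∈ e) : σ t = σ s := by
  obtain ⟨b, hab⟩ := hT.exists_adj a
  obtain ⟨r, hr⟩ := hT.exists_mem hab
  have key : ∀ x, Anc par a x → ∀ t, (∃ e ∈ inc t, x ∈ e) → σ t = σ r := by
    intro x hx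
    have hxU : x ∉ U := fun h => ha (hx.mem hU h)
    revert hxU
    refine hp.induct (P := fun x => x ∉ U → ∀ t, (∃ e ∈ inc t, x ∈ e) → σ t = σ r) ?_ ?_ hx
    · rintro - t ⟨e, he, hae⟩
      exact hT.side_eq hp hU h ha he hae hr (by simp)
    · rintro x - hxo hax ih hxU t ⟨e, he, hxe⟩
      obtain ⟨q, hq⟩ := hT.exists_mem (hp.adj x hxo)
      rw [hT.side_eq hp hU h hxU he hxe hq (by simp)]
      exact ih (fun h => ha (hax.mem hU h)) q ⟨_, hq, by simp⟩
  rw [key x hx t ht, key y hy s hs]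

theorem dual_connected [Finite N] [Finite W] (hT : Triangulation H inc)
    (hp : IsParent H o par d) : (dual H inc o par).Connected := by
  classical
  obtain ⟨b, hob⟩ := hT.exists_adj o
  obtain ⟨r, -⟩ := hT.exists_mem hob
  have : Nonempty N := ⟨r⟩
  refine ⟨fun t s => ?_⟩
  have inc_ne : ∀ t, ∃ x, ∃ e ∈ inc t, x ∈ e := fun t => by
    obtain ⟨a, b, c, -, h, -⟩ := hT.exists_sum_eq t
    exact ⟨a, _, (h s(a, b)).2 (.inl rfl), by simp⟩
  obtain ⟨x, hx⟩ := inc_ne t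
  obtain ⟨y, hy⟩ := inc_ne s
  have := hT.side_eq_of_anc hp (σ := fun s => if (dual H inc o par).Reachable t s then 1 else 0)
    (U := ∅) (by simp) (by
      rintro e he - p q hep heq
      by_cases hpq : p = q
      · rw [hpq]
      · have : (dual H inc o par).Adj p q := ⟨hpq, e, he, hep, heq⟩
        have : (dual H inc o par).Reachable t p ↔ (dual H inc o par).Reachable t q :=
          ⟨fun h => h.trans this.reachable, fun h => h.trans this.symm.reachable⟩
        simp only [this]) (Set.notMem_empty o) (hp.anc_root x) (hp.anc_root y) hx hy
  simpa using this

end Triangulation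

theorem connected_induce_of_sep {T : SimpleGraph N} (hT : T.IsTree) {S : Set N} (hS : S.Nonempty)
    (h : ∀ x y, T.Adj x y → x ∉ S → ∀ t ∈ S, ∀ s ∈ S, (T.deleteEdges {s(x, y)}).Reachable t s) :
    (T.induce S).Connected := by
  classical
  refine connected_induce_iff.2 ⟨hS, fun t ht s hs => ?_⟩
  obtain ⟨p, hp⟩ := hT.1.exists_isPath t s
  refine ⟨p, fun x hx => ?_⟩
  by_contra hxS
  have hxs : x ≠ s := by rintro rfl; exact hxS hs
  obtain ⟨y, hxy, hy⟩ : ∃ y, T.Adj x y ∧ s(x, y) ∈ p.edges := by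
    obtain ⟨q, r, rfl⟩ := Walk.mem_support_iff_exists_append.1 hx
    cases r with
    | nil => exact absurd rfl hxs
    | cons hadj r => exact ⟨_, hadj, by simp⟩
  obtain ⟨q⟩ := h x y hxy hxS t ht s hs
  have hle : T.deleteEdges {s(x, y)} ≤ T := T.deleteEdges_le _
  have e : p = (q.mapLe hle).bypass := congrArg Subtype.val
    ((hT.2.subsingleton_path t s).elim ⟨p, hp⟩ ⟨_, (q.mapLe hle).bypass_isPath⟩)
  have h1 : s(x, y) ∈ (q.mapLe hle).bypass.edges := by
    rwa [← e]
  have h2 := (q.mapLe hle).edges_bypass_subset_edges h1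
  rw [Walk.edges_mapLe_eq_edges] at h2
  have := q.edges_subset_edgeSet h2
  simp at this

theorem Triangulation.dual_isTree [Finite N] [Finite W] (hT : Triangulation H inc)
    (hp : IsParent H o par d) : (dual H inc o par).IsTree :=
  ⟨hT.dual_connected hp, hT.isAcyclic_dual hp⟩

theorem Triangulation.connected_induce [Finite N] [Finite W] (hT : Triangulation H inc)
    (hp : IsParent H o par d) (a : W) :
    ((dual H inc o par).induce {t | ∃ y, (∃ e ∈ inc t, y ∈ e) ∧ Anc par a y}).Connected := by
  classical
  obtain ⟨b, hab⟩ := hT.exists_adj a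
  obtain ⟨r, hr⟩ := hT.exists_mem hab
  refine connected_induce_of_sep (hT.dual_isTree hp) ⟨r, a, ⟨_, hr, by simp⟩, .refl a⟩ ?_
  rintro t t' htt' ht s ⟨x, hsx, hx⟩ s' ⟨y, hsy, hy⟩
  obtain ⟨hne, e, he, het, het'⟩ := htt'
  set D := (dual H inc o par).deleteEdges {s(t, t')} with hD
  have := hT.side_eq_of_anc hp (σ := fun q => if D.Reachable s q then 1 else 0)
    (U := {z | ∃ y ∈ e, Anc par z y}) (fun z ⟨y, hy, h⟩ => ⟨y, hy, (anc_par z).trans h⟩) (by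
      rintro f hf ⟨z, hzf, hz⟩ p q hfp hfq
      by_cases hpq : p = q
      · rw [hpq]
      have hef : e ≠ f := by
        rintro rfl
        exact hz ⟨z, hzf, .refl z⟩
      have : D.Adj p q := by
        rw [hD, deleteEdges_adj]
        refine ⟨⟨hpq, f, hf, hfp, hfq⟩, fun h => hef ?_⟩
        rcases Sym2.eq_iff.1 h with ⟨rfl, rfl⟩ | ⟨rfl, rfl⟩
        exacts [hT.cotree_unique hp he hf hne het het' hfp hfq,
          hT.cotree_unique hp he hf hne het het' hfq hfp]
      have : D.Reachable s p ↔ D.Reachable s q :=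
        ⟨fun h => h.trans this.reachable, fun h => h.trans this.symm.reachable⟩
      simp only [this]) (a := a) (fun ⟨y, hy, h⟩ => ht ⟨y, ⟨e, het, hy⟩, h⟩) hx hy hsx hsy
  simpa using this

end

/-! ### The stellar triangulation of a 3-connected planar graph -/

section

variable {V : Type*} {G : SimpleGraph V}

/-- `G` with a new vertex adjacent to the whole of each peripheral cycle. -/
def stellar (G : SimpleGraph V) : SimpleGraph (V ⊕ {S // Peripheral G S}) where
  Adj
    | .inl x, .inl y => G.Adj x y
    | .inl x, .inr S => x ∈ S.1
    | .inr S, .inl x => x ∈ S.1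
    | .inr _, .inr _ => False
  symm := ⟨by
    rintro (x | S) (y | T) h
    exacts [G.adj_symm h, h, h, h]⟩
  loopless := ⟨by
    rintro (x | S) h
    exacts [G.loopless.irrefl x h, h]⟩

/-- The triangles of `stellar G`: a peripheral cycle with one of its edges. -/
abbrev Triangle (G : SimpleGraph V) :=
  {n : {S // Peripheral G S} × Sym2 V // n.2 ∈ G.edgeSet ∧ ∀ x ∈ n.2, x ∈ n.1.1}

/-- The edges of a triangle. -/
noncomputable def sides [Finite V] (t : Triangle G) :
    Finset (Sym2 (V ⊕ {S // Peripheral G S})) :=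
  (Set.toFinite {f | f = t.1.2.map Sum.inl ∨ ∃ x ∈ t.1.2, f = s(.inl x, .inr t.1.1)}).toFinset

theorem mem_sides [Finite V] {t : Triangle G} {f : Sym2 (V ⊕ {S // Peripheral G S})} :
    f ∈ sides t ↔ f = t.1.2.map Sum.inl ∨ ∃ x ∈ t.1.2, f = s(.inl x, .inr t.1.1) :=
  Set.Finite.mem_toFinset _

theorem inl_mem_sides [Finite V] {t : Triangle G} {x y : V} :
    s(Sum.inl x, Sum.inl y) ∈ sides t ↔ t.1.2 = s(x, y) := by
  rw [mem_sides]
  constructor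
  · rintro (h | ⟨z, -, h⟩)
    · exact (Sym2.map.injective (f := (Sum.inl : V → V ⊕ {S // Peripheral G S}))
        Sum.inl_injective (a₁ := s(x, y)) h).symm
    · simp at h
  · intro h
    exact .inl (by simp [h])

theorem inr_mem_sides [Finite V] {t : Triangle G} {x : V} {S : {S // Peripheral G S}} :
    s(Sum.inl x, Sum.inr S) ∈ sides t ↔ x ∈ t.1.2 ∧ t.1.1 = S := by
  rw [mem_sides]
  constructor
  · rintro (h | ⟨z, hz, h⟩)
    · obtain ⟨a, b, e⟩ : ∃ a b, t.1.2 = s(a, b) :=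
        ⟨_, _, (Sym2.mk_surjective t.1.2).choose_spec.symm⟩
      rw [e] at h
      simp at h
    · simp at h
      exact ⟨h.1 ▸ hz, h.2.symm⟩
  · rintro ⟨h, rfl⟩
    exact .inr ⟨x, h, rfl⟩

theorem Peripheral.exists_two_adj {S : Set V} (hS : Peripheral G S) {x : V} (hx : x ∈ S) :
    ∃ a ∈ S, ∃ b ∈ S, a ≠ b ∧ G.Adj x a ∧ G.Adj x b := by
  obtain ⟨u, c, hc, hcS⟩ := hS.1
  obtain ⟨a, ha, b, hb, h⟩ := hc.exists_two_adj ((hcS x).2 hx)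
  exact ⟨a, (hcS a).1 ha, b, (hcS b).1 hb, h⟩

theorem Peripheral.nonempty {S : Set V} (hS : Peripheral G S) : S.Nonempty := by
  obtain ⟨u, c, -, hcS⟩ := hS.1
  exact ⟨u, (hcS u).1 c.start_mem_support⟩

theorem Joined.map {V' : Type*} {G' : SimpleGraph V'} (f : G →g G') {A : Set V} {B : Set V'}
    (h : ∀ x ∈ A, f x ∈ B) {x y : V} (hxy : Joined G A x y) : Joined G' B (f x) (f y) := by
  obtain ⟨p, hp⟩ := hxy
  refine ⟨p.map f, fun z hz => ?_⟩
  rw [Walk.support_map, List.mem_map] at hz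
  obtain ⟨a, ha, rfl⟩ := hz
  exact h a (hp a ha)

theorem exists_potential_stellar [Finite V] (h3 : ThreeConn G) (hc : ConnOn G Set.univ)
    (φ : Sym2 (V ⊕ {S // Peripheral G S}) → ZMod 2)
    (hφ : ∀ t : Triangle G, ∑ e ∈ sides t, φ e = 0) :
    ∃ p : V ⊕ {S // Peripheral G S} → ZMod 2, ∀ x y, (stellar G).Adj x y →
      φ s(x, y) = p x + p y := by
  classical
  have hS : ∀ (S : {S // Peripheral G S}), ∀ x ∈ S.1, ∀ y ∈ S.1, G.Adj x y →
      φ s(.inl x, .inl y) = φ s(.inl x, .inr S) + φ s(.inl y, .inr S) := by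
    intro S x hx y hy hxy
    have := hφ ⟨(S, s(x, y)), hxy, by simp [hx, hy]⟩
    have e : sides (⟨(S, s(x, y)), hxy, by simp [hx, hy]⟩ : Triangle G) =
        {s(.inl x, .inl y), s(.inl x, .inr S), s(.inl y, .inr S)} := by
      ext f
      simp [mem_sides, or_and_right, exists_or]
    rw [e, Finset.sum_insert, Finset.sum_pair] at this
    · exact CharTwo.add_eq_zero.1 this
    · simp [hxy.ne]
    · simp
  obtain ⟨p, hp⟩ := exists_potential_of_peripheral (G := G)
    (φ := fun x y => φ s(.inl x, .inl y)) (fun x y => by rw [Sym2.eq_swap]) h3 hc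
    fun S hS' => ⟨fun x => φ s(.inl x, .inr ⟨S, hS'⟩), hS ⟨S, hS'⟩⟩
  have hconst : ∀ S : {S // Peripheral G S}, ∀ x ∈ S.1, ∀ y ∈ S.1,
      p x + φ s(.inl x, .inr S) = p y + φ s(.inl y, .inr S) := by
    intro S x hx y hy
    obtain ⟨q, hq⟩ := S.2.connOn x hx y hy
    induction q with
    | nil => rfl
    | @cons a b c hab q ih =>
      have hb : b ∈ S.1 := hq b (by simp)
      rw [← ih hb hy fun z hz => hq z (by simp [hz])]
      have h1 := hS S a hx b hb hab
      rw [hp a b hab] at h1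
      generalize p a = A at *
      generalize p b = B at *
      generalize φ s(.inl a, .inr S) = C at *
      generalize φ s(.inl b, .inr S) = D at *
      clear * - h1
      revert h1 A B C D
      decide
  refine ⟨Sum.elim p fun S => p S.2.nonempty.some + φ s(.inl S.2.nonempty.some, .inr S), ?_⟩
  have hmix : ∀ x (S : {S // Peripheral G S}), x ∈ S.1 → φ s(.inl x, .inr S) =
      p x + (p S.2.nonempty.some + φ s(.inl S.2.nonempty.some, .inr S)) := by
    intro x S hx
    rw [← hconst S x hx _ S.2.nonempty.some_mem, ← add_assoc, CharTwo.add_self_eq_zero, zero_add]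
  rintro (x | S) (y | T) h
  · exact hp x y h
  · exact hmix x T h
  · rw [Sym2.eq_swap, add_comm]
    exact hmix y S h
  · exact h.elim

theorem exists_two_triangles [Finite V] (hG : Planar G) (h3 : ThreeConn G)
    (h4 : ∀ a b c : V, ∃ d, d ≠ a ∧ d ≠ b ∧ d ≠ c) {x y : V ⊕ {S // Peripheral G S}}
    (h : (stellar G).Adj x y) :
    ∃ t t' : Triangle G, t ≠ t' ∧ ∀ r, s(x, y) ∈ sides r ↔ r = t ∨ r = t' := by
  have hmix : ∀ x (S : {S // Peripheral G S}), x ∈ S.1 →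
      ∃ t t' : Triangle G, t ≠ t' ∧ ∀ r, s(.inl x, .inr S) ∈ sides r ↔ r = t ∨ r = t' := by
    intro x S hx
    obtain ⟨a, ha, b, hb, hab, hxa, hxb⟩ := S.2.exists_two_adj hx
    refine ⟨⟨(S, s(x, a)), hxa, by simp [hx, ha]⟩, ⟨(S, s(x, b)), hxb, by simp [hx, hb]⟩,
      fun h => ?_, fun r => ?_⟩
    · simp [hab] at h
      exact hxb.ne h.1
    · rw [inr_mem_sides]
      obtain ⟨⟨R, e⟩, he, hR⟩ := r
      simp only [Subtype.mk.injEq, Prod.mk.injEq]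
      constructor
      · rintro ⟨⟨c, rfl⟩, h⟩
        obtain rfl := h.symm
        rcases S.2.adj_eq hx ha hb (hR c (by simp)) hxa hxb he hab with rfl | rfl <;> simp
      · rintro (⟨rfl, rfl⟩ | ⟨rfl, rfl⟩) <;> simp
  rcases x with x | S <;> rcases y with y | T
  · have hxy : G.Adj x y := h
    obtain ⟨S₁, S₂, h₁, h₂, hne, hx₁, hy₁, hx₂, hy₂, hall⟩ := exists_two_peripheral hG h3 h4 hxy
    refine ⟨⟨(⟨S₁, h₁⟩, s(x, y)), hxy, by simp [hx₁, hy₁]⟩,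
      ⟨(⟨S₂, h₂⟩, s(x, y)), hxy, by simp [hx₂, hy₂]⟩, fun h => hne (by simpa using h), fun r => ?_⟩
    rw [inl_mem_sides]
    obtain ⟨⟨⟨R, hR⟩, e⟩, he, hR'⟩ := r
    simp only [Subtype.mk.injEq, Prod.mk.injEq]
    constructor
    · rintro rfl
      simpa using hall R hR (hR' x (by simp)) (hR' y (by simp))
    · rintro (⟨-, rfl⟩ | ⟨-, rfl⟩) <;> rfl
  · exact hmix x T h
  · rw [Sym2.eq_swap]
    exact hmix y S h
  · exact h.elim

theorem ThreeConn.connOn_univ (h3 : ThreeConn G)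
    (h4 : ∀ a b c : V, ∃ d, d ≠ a ∧ d ≠ b ∧ d ≠ c) : ConnOn G Set.univ := fun x _ y _ => by
  obtain ⟨z, hx, hy, -⟩ := h4 x y y
  exact (h3 z z x (by simp [hx.symm]) y (by simp [hy.symm])).mono (Set.subset_univ _)

theorem triangulation_stellar [Finite V] (hG : Planar G) (h3 : ThreeConn G)
    (h4 : ∀ a b c : V, ∃ d, d ≠ a ∧ d ≠ b ∧ d ≠ c) :
    Triangulation (stellar G) (sides (G := G)) where
  mem_edgeSet := by
    rintro ⟨⟨S, e⟩, he, hS⟩ f hf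
    rcases mem_sides.1 hf with rfl | ⟨x, hx, rfl⟩
    · induction e using Sym2.ind with
      | _ x y => exact he
    · exact hS x hx
  exists_triangle := by
    rintro ⟨⟨S, e⟩, he, hS⟩
    induction e using Sym2.ind with
    | _ x y =>
      have hxy : G.Adj x y := he
      refine ⟨.inl x, .inl y, .inr S, by simpa using hxy.ne, by simp, by simp, fun f => ?_⟩
      rw [mem_sides]
      simp [or_and_right, exists_or]
      tauto
  exists_two e he := by
    induction e using Sym2.ind with
    | _ x y => exact exists_two_triangles hG h3 h4 he
  exists_potential := exists_potential_stellar h3 (h3.connOn_univ h4)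
  exists_adj := by
    rintro (x | S)
    · obtain ⟨z, hz, -⟩ := h4 x x x
      obtain ⟨y, hy, -⟩ := h3.exists_adj h4 hz.symm hz.symm
      exact ⟨.inl y, hy⟩
    · exact ⟨.inl S.2.nonempty.some, S.2.nonempty.some_mem⟩
  connOn w := by
    let f : G →g stellar G := ⟨Sum.inl, fun h => h⟩
    have hA : ConnOn G {x | Sum.inl x ≠ w} := by
      rcases w with u | S
      · convert h3 u u using 1
        ext x
        simp
      · convert h3.connOn_univ h4 using 1
        ext x
        simp
    have hrep : ∀ z, z ≠ w → ∃ x, Sum.inl x ≠ w ∧ Joined (stellar G) {w}ᶜ z (Sum.inl x) := by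
      rintro (x | S) hz
      · exact ⟨x, hz, .refl hz⟩
      · obtain ⟨c, hc⟩ := S.2.nonempty
        obtain ⟨a, ha, b, hb, hab, -⟩ := S.2.exists_two_adj hc
        by_cases haw : Sum.inl a = w
        · have hbw : Sum.inl b ≠ w := fun e => hab (Sum.inl_injective (haw.trans e.symm))
          exact ⟨b, hbw, .of_adj hz hbw hb⟩
        · exact ⟨a, haw, .of_adj hz haw ha⟩
    intro z hz z' hz'
    obtain ⟨x, hx, h1⟩ := hrep z hz
    obtain ⟨y, hy, h2⟩ := hrep z' hz'
    exact (h1.trans ((hA x hx y hy).map f (B := {w}ᶜ) fun _ h => h)).trans h2.symm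

end

/-! ### Treewidth of 3-connected planar graphs -/

section

theorem exists_adj_dist_lt {V : Type*} {G : SimpleGraph V} {o x : V} (h : G.Reachable o x)
    (hx : x ≠ o) : ∃ y, G.Adj x y ∧ G.dist o y < G.dist o x := by
  obtain ⟨p, hp⟩ := h.symm.exists_walk_length_eq_dist
  cases p with
  | nil => exact absurd rfl hx
  | @cons _ y _ hxy q =>
    refine ⟨y, hxy, ?_⟩
    rw [G.dist_comm, G.dist_comm (u := o), ← hp, Walk.length_cons]
    exact Nat.lt_succ_of_le (G.dist_le q)

theorem iterate_lt {V : Type*} {d : V → ℕ} {o : V} {par : V → V} (ho : par o = o)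
    (hd : ∀ x, x ≠ o → d (par x) < d x) {x : V} {k : ℕ} (h : par^[k] x ≠ o) : k < d x := by
  induction k generalizing x with
  | zero => exact (Nat.zero_le _).trans_lt (hd x h)
  | succ k ih =>
    have hx : x ≠ o := by
      rintro rfl
      exact h (Function.iterate_fixed ho _)
    have := ih (x := par x) h
    have := hd x hx
    omega

theorem hasTreewidthAtMost_of_threeConn {V : Type} [Finite V] {G : SimpleGraph V} (hG : Planar G)
    (h3 : ThreeConn G) (h4 : ∀ a b c : V, ∃ d, d ≠ a ∧ d ≠ b ∧ d ≠ c) {o : V} {r : ℕ}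
    (hr : ∀ x, ∃ p : G.Walk o x, p.length ≤ r) : hasTreewidthAtMost G (3 * r) := by
  classical
  have hT := triangulation_stellar hG h3 h4
  have hpar : ∀ x, ∃ y, (x = o → y = o) ∧ (x ≠ o → G.Adj x y ∧ G.dist o y < G.dist o x) := by
    intro x
    by_cases hx : x = o
    · exact ⟨o, fun _ => rfl, fun h => absurd hx h⟩
    · obtain ⟨y, hy⟩ := exists_adj_dist_lt ⟨(hr x).choose⟩ hx
      exact ⟨y, fun h => absurd h hx, fun _ => hy⟩
  choose par hparo hpar using hpar
  have hparo := hparo o rfl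
  let center : {S // Peripheral G S} → V := fun S => S.2.nonempty.some
  let par' : V ⊕ {S // Peripheral G S} → V ⊕ {S // Peripheral G S} :=
    Sum.elim (fun x => .inl (par x)) fun S => .inl (center S)
  let d : V ⊕ {S // Peripheral G S} → ℕ := Sum.elim (G.dist o) fun S => G.dist o (center S) + 1
  have hp : IsParent (stellar G) (.inl o) par' d :=
    { root := congrArg Sum.inl hparo
      adj := by
        rintro (x | S) hx
        · exact (hpar x (by simpa using hx)).1
        · exact S.2.nonempty.some_mem
      lt := by
        rintro (x | S) hx
        · exact (hpar x (by simpa using hx)).2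
        · exact Nat.lt_succ_self _ }
  have hiter : ∀ x k, par'^[k] (.inl x) = .inl (par^[k] x) := by
    intro x k
    induction k generalizing x with
    | zero => rfl
    | succ k ih => exact ih (par x)
  have hdist : ∀ x, G.dist o x ≤ r := fun x => by
    obtain ⟨p, hp⟩ := hr x
    exact (G.dist_le p).trans hp
  have hanc : ∀ x y, Anc par' (.inl x) (.inl y) →
      x = o ∨ x ∈ (Finset.range r).image fun k => par^[k] y := by
    rintro x y ⟨k, hk⟩
    rw [hiter] at hk
    obtain rfl := Sum.inl_injective hk
    by_cases ho : par^[k] y = o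
    · exact .inl ho
    · refine .inr (Finset.mem_image_of_mem _ (Finset.mem_range.2 ?_))
      exact (iterate_lt hparo (fun x hx => (hpar x hx).2) ho).trans_le (hdist y)
  refine ⟨Triangle G, dual (stellar G) sides (.inl o) par', fun t =>
    {x | ∃ y, (∃ e ∈ sides t, y ∈ e) ∧ Anc par' (.inl x) y}, hT.dual_isTree hp, fun v => ?_,
    fun u v huv => ?_, fun v => hT.connected_induce hp (.inl v), fun t => ?_⟩
  · obtain ⟨⟨t, ht⟩⟩ := (hT.connected_induce hp (.inl v)).nonempty
    exact ⟨t, ht⟩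
  · obtain ⟨t, ht⟩ := hT.exists_mem (x := .inl u) (y := .inl v) huv
    exact ⟨t, ⟨_, ⟨_, ht, by simp⟩, .refl _⟩, _, ⟨_, ht, by simp⟩, .refl _⟩
  · obtain ⟨⟨S, e⟩, he, hS⟩ := t
    induction e using Sym2.ind with
    | _ a b =>
      let I : V → Finset V := fun y => (Finset.range r).image fun k => par^[k] y
      have hI : ∀ y, (I y).card ≤ r := fun y => Finset.card_image_le.trans (by simp)
      have hsub : {x | ∃ y, (∃ e ∈ sides (⟨(S, s(a, b)), he, hS⟩ : Triangle G), y ∈ e) ∧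
          Anc par' (.inl x) y} ⊆ ↑(insert o (I a ∪ I b ∪ I (center S))) := by
        rintro x ⟨y, ⟨f, hf, hy⟩, hx⟩
        have hy' : y = .inl a ∨ y = .inl b ∨ y = .inr S := by
          rcases mem_sides.1 hf with rfl | ⟨z, hz, rfl⟩
          · have : y = .inl a ∨ y = .inl b := by simpa using hy
            tauto
          · have h1 : z = a ∨ z = b := by simpa using hz
            have h2 : y = .inl z ∨ y = .inr S := by simpa using hy
            rcases h1 with rfl | rfl <;> tauto
        simp only [Finset.coe_insert, Finset.coe_union, Set.mem_insert_iff, Set.mem_union,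
          Finset.mem_coe]
        rcases hy' with rfl | rfl | rfl
        · rcases hanc x a hx with h | h
          exacts [.inl h, .inr (.inl (.inl h))]
        · rcases hanc x b hx with h | h
          exacts [.inl h, .inr (.inl (.inr h))]
        · rcases hx.eq_or with h | h
          · simp at h
          rcases hanc x _ h with h | h
          exacts [.inl h, .inr (.inr h)]
      refine (Set.ncard_le_ncard hsub (Finset.finite_toSet _)).trans ?_
      rw [Set.ncard_coe_finset]
      have h1 := Finset.card_insert_le o (I a ∪ I b ∪ I (center S))
      have h2 := Finset.card_union_le (I a ∪ I b) (I (center S))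
      have h3 := Finset.card_union_le (I a) (I b)
      have := hI a
      have := hI b
      have := hI (center S)
      omega

end

/-! ### Reduction to 3-connected graphs -/

section

variable {V V' : Type*} {G : SimpleGraph V} {G' : SimpleGraph V'}

/-! #### Minor models -/

theorem Joined.of_model {M : V' → Set V} (hM : ∀ x, Blob G (M x))
    (ht : ∀ x y, G'.Adj x y → Touch G (M x) (M y)) {S : Set V'} {x y : V'}
    (h : Joined G' S x y) {a b : V} (ha : a ∈ M x) (hb : b ∈ M y) :
    Joined G (⋃ z ∈ S, M z) a b := by
  obtain ⟨p, hp⟩ := h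
  induction p generalizing a with
  | @nil z =>
    exact ((hM z).2 a ha b hb).mono (Set.subset_biUnion_of_mem (hp z (by simp)))
  | @cons x y z hxy q ih =>
    obtain ⟨c, hc, c', hc', hcc⟩ := ht x y hxy
    have hxS : M x ⊆ ⋃ z ∈ S, M z := Set.subset_biUnion_of_mem (hp x (by simp))
    have hyS : M y ⊆ ⋃ z ∈ S, M z := Set.subset_biUnion_of_mem (hp y (by simp))
    exact (((hM x).2 a ha c hc).mono hxS).trans <|
      (Joined.of_adj (hxS hc) (hyS hc') hcc).trans <|
      ih hc' hb fun w hw => hp w (by simp [hw])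

theorem hasMinor_of_model {W : Type*} {H : SimpleGraph W} {M : V' → Set V}
    (hM : ∀ x, Blob G (M x)) (hd : ∀ x y, x ≠ y → Disjoint (M x) (M y))
    (ht : ∀ x y, G'.Adj x y → Touch G (M x) (M y)) (h : HasMinor G' H) : HasMinor G H := by
  rw [hasMinor_iff] at h ⊢
  obtain ⟨B, hB, hBd, hBt⟩ := h
  refine ⟨fun w => ⋃ x ∈ B w, M x, fun w => ⟨?_, ?_⟩, fun w w' hw => ?_, fun w w' hw => ?_⟩
  · obtain ⟨x, hx⟩ := (hB w).1
    exact (hM x).1.mono (Set.subset_biUnion_of_mem hx)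
  · intro a ha b hb
    obtain ⟨x, hx, ha⟩ := Set.mem_iUnion₂.1 ha
    obtain ⟨y, hy, hb⟩ := Set.mem_iUnion₂.1 hb
    exact ((hB w).2 x hx y hy).of_model hM ht ha hb
  · rw [Set.disjoint_left]
    intro a ha hb
    obtain ⟨x, hx, ha⟩ := Set.mem_iUnion₂.1 ha
    obtain ⟨y, hy, hb⟩ := Set.mem_iUnion₂.1 hb
    have hxy : x ≠ y := by
      rintro rfl
      exact Set.disjoint_left.1 (hBd w w' hw) hx hy
    exact Set.disjoint_left.1 (hd x y hxy) ha hb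
  · obtain ⟨x, hx, y, hy, hxy⟩ := hBt w w' hw
    exact (ht x y hxy).mono (Set.subset_biUnion_of_mem hx) (Set.subset_biUnion_of_mem hy)

theorem planar_of_model (hG : Planar G) {M : V' → Set V} (hM : ∀ x, Blob G (M x))
    (hd : ∀ x y, x ≠ y → Disjoint (M x) (M y))
    (ht : ∀ x y, G'.Adj x y → Touch G (M x) (M y)) : Planar G' :=
  ⟨fun h => hG.1 (hasMinor_of_model hM hd ht h), fun h => hG.2 (hasMinor_of_model hM hd ht h)⟩

theorem planar_of_embedding (hG : Planar G) (f : G' ↪g G) : Planar G' := by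
  refine planar_of_model hG (M := fun x => {f x}) (fun x => blob_singleton _) (fun x y hxy => ?_)
    fun x y hxy => ⟨f x, rfl, f y, rfl, f.map_adj_iff.2 hxy⟩
  simpa using hxy

/-- One side of a separation of order at most two, with the separator made adjacent. -/
abbrev torso (G : SimpleGraph V) (S : Set V) (u w : V) : SimpleGraph S :=
  (G ⊔ edge u w).induce S

theorem planar_torso (hG : Planar G) {S L : Set V} {u w : V} (hL : ConnOn G L)
    (hLS : Disjoint L S) (hu : Touch G {u} L) (hw : Touch G {w} L) :
    Planar (torso G S u w) := by
  classical
  let M : S → Set V := fun x => if x.1 = u then insert u L else {x.1}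
  have hself : ∀ x, x.1 ∈ M x := by
    intro x
    by_cases hx : x.1 = u <;> simp [M, hx]
  have hsub : ∀ x, ∀ z ∈ M x, z = x.1 ∨ z ∈ L := by
    intro x z hz
    by_cases hx : x.1 = u
    · simpa [M, hx] using hz
    · exact .inl (by simpa [M, hx] using hz)
  have hML : ∀ x, ∀ z ∈ M x, z ∈ L → x.1 = u := by
    intro x z hz hzL
    by_contra hx
    have : z = x.1 := by simpa [M, hx] using hz
    exact Set.disjoint_left.1 hLS hzL (this ▸ x.2)
  have huw : ∀ x y : S, x.1 = u → y.1 = w → Touch G (M x) (M y) := by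
    intro x y hx hy
    obtain ⟨_, h, b, hb, hwb⟩ := hw
    obtain rfl : _ = w := h
    exact ⟨b, by simp [M, hx, hb], _, hy ▸ hself y, hwb.symm⟩
  refine planar_of_model hG (M := M) (fun x => ⟨⟨x.1, hself x⟩, ?_⟩) (fun x y hxy => ?_)
    fun x y hxy => ?_
  · by_cases hx : x.1 = u
    · obtain ⟨_, rfl, b, hb, hub⟩ := hu
      simpa [M, hx] using hL.insert hb hub
    · simpa [M, hx] using connOn_singleton x.1
  · rw [Set.disjoint_left]
    intro z hzx hzy
    apply hxy
    rcases hsub x z hzx with h | h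
    · rcases hsub y z hzy with h' | h'
      · exact Subtype.ext (h.symm.trans h')
      · exact absurd (h ▸ x.2) (Set.disjoint_left.1 hLS h')
    · exact Subtype.ext ((hML x z hzx h).trans (hML y z hzy h).symm)
  · rcases hxy with h | h
    · exact ⟨x, hself x, y, hself y, h⟩
    · have h : (edge u w).Adj x.1 y.1 := h
      rw [edge_adj] at h
      rcases h.1 with ⟨h1, h2⟩ | ⟨h1, h2⟩
      · exact huw x y h1 h2
      · exact (huw y x h2 h1).symm

/-! #### Contracting walks -/

theorem exists_walk_length_le_of_collapse (f : V → V')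
    (hf : ∀ x y, G.Adj x y → f x = f y ∨ G'.Adj (f x) (f y)) {x y : V} (p : G.Walk x y) :
    ∃ q : G'.Walk (f x) (f y), q.length ≤ p.length := by
  induction p with
  | nil => exact ⟨.nil, le_rfl⟩
  | @cons x y z hxy p ih =>
    obtain ⟨q, hq⟩ := ih
    rcases hf x y hxy with h | h
    · refine ⟨q.copy h.symm rfl, ?_⟩
      simp only [Walk.length_copy, Walk.length_cons]
      omega
    · exact ⟨q.cons h, by simpa using hq⟩

theorem torso_radius {S : Set V} {u w : V} (hu : u ∈ S) (hw : w ∈ S)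
    (hS : ∀ x ∈ S, ∀ y ∉ S, G.Adj x y → x = u ∨ x = w) {o : V} {r : ℕ}
    (hr : ∀ x, ∃ p : G.Walk o x, p.length ≤ r) :
    ∃ o', ∀ x, ∃ p : (torso G S u w).Walk o' x, p.length ≤ r := by
  classical
  let f : V → S := fun x => if hx : x ∈ S then ⟨x, hx⟩ else ⟨u, hu⟩
  have hin : ∀ x (hx : x ∈ S), f x = ⟨x, hx⟩ := fun x hx => by simp [f, hx]
  have hout : ∀ x, x ∉ S → f x = ⟨u, hu⟩ := fun x hx => by simp [f, hx]
  have hedge : ∀ x ∈ S, ∀ y ∉ S, G.Adj x y → f x = f y ∨ (torso G S u w).Adj (f x) (f y) := by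
    intro x hx y hy hxy
    rw [hin x hx, hout y hy]
    rcases hS x hx y hy hxy with rfl | rfl
    · exact .inl rfl
    · by_cases hxu : x = u
      · exact .inl (Subtype.ext hxu)
      · exact .inr (.inr ((edge_adj _ _ _ _).2 ⟨.inr ⟨rfl, rfl⟩, hxu⟩))
  refine ⟨f o, fun x => ?_⟩
  obtain ⟨p, hp⟩ := hr x
  have hf : ∀ a b, G.Adj a b → f a = f b ∨ (torso G S u w).Adj (f a) (f b) := by
    intro a b hab
    by_cases ha : a ∈ S <;> by_cases hb : b ∈ S
    · rw [hin a ha, hin b hb]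
      exact .inr (.inl hab)
    · exact hedge a ha b hb hab
    · exact (hedge b hb a ha hab.symm).imp Eq.symm Adj.symm
    · exact .inl ((hout a ha).trans (hout b hb).symm)
  obtain ⟨q, hq⟩ := exists_walk_length_le_of_collapse f hf p
  exact ⟨q.copy rfl (hin x x.2), by simpa using hq.trans hp⟩

/-! #### Gluing tree decompositions -/

theorem isAcyclic_sum (hG : G.IsAcyclic) (hG' : G'.IsAcyclic) : (G ⊕g G').IsAcyclic := by
  rw [isAcyclic_iff_forall_adj_isBridge] at hG hG' ⊢
  rintro (a | a) (b | b) hab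
  · have h := hG (v := a) (w := b) hab
    rw [isBridge_iff] at h ⊢
    refine fun hr => h ?_
    obtain ⟨p⟩ := hr
    refine (exists_walk_length_le_of_collapse (G' := G.deleteEdges {s(a, b)})
      (Sum.elim id fun _ => a) ?_ p).nonempty
    rintro (x | x) (y | y) hxy <;> simp_all [deleteEdges_adj]
  · cases hab
  · cases hab
  · have h := hG' (v := a) (w := b) hab
    rw [isBridge_iff] at h ⊢
    refine fun hr => h ?_
    obtain ⟨p⟩ := hr
    refine (exists_walk_length_le_of_collapse (G' := G'.deleteEdges {s(a, b)})
      (Sum.elim (fun _ => a) id) ?_ p).nonempty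
    rintro (x | x) (y | y) hxy <;> simp_all [deleteEdges_adj]

theorem Blob.image {S : Set V} (h : Blob G S) (f : G →g G') : Blob G' (f '' S) := by
  refine ⟨h.1.image f, ?_⟩
  rintro _ ⟨x, hx, rfl⟩ _ ⟨y, hy, rfl⟩
  exact Joined.map f (fun z hz => Set.mem_image_of_mem f hz) (h.2 x hx y hy)

theorem Blob.union {S T : Set V} (hS : Blob G S) (hT : Blob G T) (h : Touch G S T) :
    Blob G (S ∪ T) :=
  ⟨hS.1.inl, hS.2.union hT.2 h⟩

theorem connected_iff_blob_univ : G.Connected ↔ Blob G Set.univ := by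
  constructor
  · intro h
    obtain ⟨x⟩ := h.nonempty
    refine ⟨⟨x, trivial⟩, fun a _ b _ => ?_⟩
    obtain ⟨p⟩ := h.preconnected a b
    exact ⟨p, fun _ _ => trivial⟩
  · rintro ⟨⟨x, -⟩, h⟩
    refine (SimpleGraph.connected_iff _).2 ⟨fun a b => ?_, ⟨x⟩⟩
    obtain ⟨p, -⟩ := h a trivial b trivial
    exact ⟨p⟩

theorem exists_bag_torso {S : Set V} {u w : V} (hu : u ∈ S) (hw : w ∈ S) {T : Type}
    {β : T → Set S} (h1 : ∀ v, ∃ x, v ∈ β x)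
    (h2 : ∀ a b, (torso G S u w).Adj a b → ∃ x, a ∈ β x ∧ b ∈ β x) :
    ∃ x, (⟨u, hu⟩ : S) ∈ β x ∧ (⟨w, hw⟩ : S) ∈ β x := by
  by_cases huw : u = w
  · subst huw
    obtain ⟨x, hx⟩ := h1 ⟨u, hu⟩
    exact ⟨x, hx, hx⟩
  · exact h2 _ _ (.inr ((edge_adj _ _ _ _).2 ⟨.inl ⟨rfl, rfl⟩, huw⟩))

theorem hasTreewidthAtMost_of_torsos {S₁ S₂ : Set V} {u w : V} (hu₁ : u ∈ S₁) (hw₁ : w ∈ S₁)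
    (hu₂ : u ∈ S₂) (hw₂ : w ∈ S₂) (hunion : ∀ x, x ∈ S₁ ∨ x ∈ S₂)
    (hinter : ∀ x ∈ S₁, x ∈ S₂ → x = u ∨ x = w)
    (hadj : ∀ x y, G.Adj x y → x ∈ S₁ ∧ y ∈ S₁ ∨ x ∈ S₂ ∧ y ∈ S₂) {k : ℕ}
    (h₁ : hasTreewidthAtMost (torso G S₁ u w) k) (h₂ : hasTreewidthAtMost (torso G S₂ u w) k) :
    hasTreewidthAtMost G k := by
  obtain ⟨T₁, Tg₁, β₁, htree₁, hv₁, he₁, hc₁, hn₁⟩ := h₁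
  obtain ⟨T₂, Tg₂, β₂, htree₂, hv₂, he₂, hc₂, hn₂⟩ := h₂
  obtain ⟨x₁, hxu₁, hxw₁⟩ := exists_bag_torso hu₁ hw₁ hv₁ he₁
  obtain ⟨x₂, hxu₂, hxw₂⟩ := exists_bag_torso hu₂ hw₂ hv₂ he₂
  let Tg : SimpleGraph (T₁ ⊕ T₂) := (Tg₁ ⊕g Tg₂) ⊔ edge (.inl x₁) (.inr x₂)
  let f₁ : Tg₁ →g Tg := ⟨Sum.inl, fun h => .inl h⟩
  let f₂ : Tg₂ →g Tg := ⟨Sum.inr, fun h => .inl h⟩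
  have hx : Tg.Adj (.inl x₁) (.inr x₂) := .inr ((edge_adj _ _ _ _).2 ⟨.inl ⟨rfl, rfl⟩, by simp⟩)
  let β : T₁ ⊕ T₂ → Set V := Sum.elim (fun t => (↑) '' β₁ t) fun t => (↑) '' β₂ t
  have hβ₁ : ∀ t v, v ∈ β (.inl t) ↔ ∃ h : v ∈ S₁, (⟨v, h⟩ : S₁) ∈ β₁ t := by simp [β]
  have hβ₂ : ∀ t v, v ∈ β (.inr t) ↔ ∃ h : v ∈ S₂, (⟨v, h⟩ : S₂) ∈ β₂ t := by simp [β]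
  refine ⟨T₁ ⊕ T₂, Tg, β, ⟨connected_iff_blob_univ.2 ?_, ?_⟩, fun v => ?_, fun a b hab => ?_,
    fun v => connected_induce_iff.2 ?_, ?_⟩
  · have := ((connected_iff_blob_univ.1 htree₁.1).image f₁).union
      ((connected_iff_blob_univ.1 htree₂.1).image f₂)
      ⟨_, ⟨x₁, trivial, rfl⟩, _, ⟨x₂, trivial, rfl⟩, hx⟩
    convert this
    ext (t | t) <;> simp [f₁, f₂]
  · exact (isAcyclic_sum htree₁.2 htree₂.2).sup_edge_of_not_reachable
      (not_reachable_sum_inl_inr _ _)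
  · rcases hunion v with h | h
    · obtain ⟨t, ht⟩ := hv₁ ⟨v, h⟩
      exact ⟨.inl t, (hβ₁ t v).2 ⟨h, ht⟩⟩
    · obtain ⟨t, ht⟩ := hv₂ ⟨v, h⟩
      exact ⟨.inr t, (hβ₂ t v).2 ⟨h, ht⟩⟩
  · rcases hadj a b hab with ⟨ha, hb⟩ | ⟨ha, hb⟩
    · obtain ⟨t, hta, htb⟩ := he₁ ⟨a, ha⟩ ⟨b, hb⟩ (.inl hab)
      exact ⟨.inl t, (hβ₁ t a).2 ⟨ha, hta⟩, (hβ₁ t b).2 ⟨hb, htb⟩⟩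
    · obtain ⟨t, hta, htb⟩ := he₂ ⟨a, ha⟩ ⟨b, hb⟩ (.inl hab)
      exact ⟨.inr t, (hβ₂ t a).2 ⟨ha, hta⟩, (hβ₂ t b).2 ⟨hb, htb⟩⟩
  · have b₁ (h : v ∈ S₁) := Blob.image (connected_induce_iff.1 (hc₁ ⟨v, h⟩)) f₁
    have b₂ (h : v ∈ S₂) := Blob.image (connected_induce_iff.1 (hc₂ ⟨v, h⟩)) f₂
    change Blob Tg _
    by_cases m₁ : v ∈ S₁
    · by_cases m₂ : v ∈ S₂
      · convert (b₁ m₁).union (b₂ m₂) ?_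
        · ext (t | t) <;> simp [f₁, f₂, hβ₁, hβ₂, m₁, m₂]
        · refine ⟨_, ⟨x₁, ?_, rfl⟩, _, ⟨x₂, ?_, rfl⟩, hx⟩
          · rcases hinter v m₁ m₂ with rfl | rfl
            exacts [hxu₁, hxw₁]
          · rcases hinter v m₁ m₂ with rfl | rfl
            exacts [hxu₂, hxw₂]
      · convert b₁ m₁
        ext (t | t) <;> simp [f₁, hβ₁, hβ₂, m₁, m₂]
    · have m₂ := (hunion v).resolve_left m₁
      convert b₂ m₂
      ext (t | t) <;> simp [f₂, hβ₁, hβ₂, m₁, m₂]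
  · rintro (t | t)
    · exact (Set.ncard_image_of_injective _ Subtype.val_injective).trans_le (hn₁ t)
    · exact (Set.ncard_image_of_injective _ Subtype.val_injective).trans_le (hn₂ t)

theorem hasTreewidthAtMost_of_card_le {k : ℕ} (h : Nat.card V ≤ k + 1) :
    hasTreewidthAtMost G k := by
  refine ⟨Unit, ⊥, fun _ => Set.univ, IsTree.of_subsingleton, fun _ => ⟨(), trivial⟩,
    fun _ _ _ => ⟨(), trivial, trivial⟩, fun v => ?_, fun _ => by simpa using h⟩
  exact connected_induce_iff.2 ⟨⟨(), trivial⟩, fun _ _ _ _ => Joined.refl trivial⟩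

theorem hasTreewidthAtMost_of_iso (e : G ≃g G') {k : ℕ} (h : hasTreewidthAtMost G' k) :
    hasTreewidthAtMost G k := by
  obtain ⟨T, Tg, β, htree, hv, he, hc, hn⟩ := h
  refine ⟨T, Tg, fun t => e ⁻¹' β t, htree, fun v => hv (e v),
    fun a b hab => he _ _ (e.map_adj_iff.2 hab), fun v => hc (e v), fun t => ?_⟩
  rw [Set.ncard_preimage_of_injective_subset_range e.injective
    (by simp [e.surjective.range_eq])]
  exact hn t

/-- `A` is a union of components after deleting `u` and `w`; `A` and `B` are disjoint, connected
and link `u` to `w`. -/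
structure Separation (G : SimpleGraph V) (u w : V) (A B : Set V) : Prop where
  disjoint : Disjoint A B
  left_closed : ∀ x ∈ A, ∀ y, G.Adj x y → y ∈ A ∨ y = u ∨ y = w
  mem_left : u ∉ A ∧ w ∉ A
  mem_right : u ∉ B ∧ w ∉ B
  conn_left : ConnOn G A
  conn_right : ConnOn G B
  touch_left : Touch G {u} A ∧ Touch G {w} A
  touch_right : Touch G {u} B ∧ Touch G {w} B

theorem separation_of_not_connOn {u w : V} (h : ¬ConnOn G {u, w}ᶜ)
    (hu : u = w ∨ ConnOn G {u}ᶜ) (hw : u = w ∨ ConnOn G {w}ᶜ) (hG : G.Connected) :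
    ∃ A B, Separation G u w A B := by
  unfold ConnOn at h
  push Not at h
  obtain ⟨x, hx, y, hy, hxy⟩ := h
  have hclosed : ∀ z, ∀ a ∈ comp G {u, w}ᶜ z, ∀ b, G.Adj a b →
      b ∈ comp G {u, w}ᶜ z ∨ b = u ∨ b = w := by
    intro z a ha b hab
    by_cases hb : b ∈ ({u, w} : Set V)
    · exact .inr hb
    · exact .inl (comp_closed ha hb hab)
  have hnot : ∀ z, u ∉ comp G {u, w}ᶜ z ∧ w ∉ comp G {u, w}ᶜ z := fun z =>
    ⟨fun h => comp_subset h (.inl rfl), fun h => comp_subset h (.inr rfl)⟩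
  have htouch : ∀ z z', z ∈ ({u, w} : Set V)ᶜ → z' ∈ ({u, w} : Set V)ᶜ →
      z' ∉ comp G {u, w}ᶜ z → ∀ s t, ({s, t} : Set V) = {u, w} → (s = t ∨ ConnOn G {t}ᶜ) →
      Touch G {s} (comp G {u, w}ᶜ z) := by
    intro z z' hz hz' hzz s t hst hs
    have hj : ∃ S, Joined G S z z' ∧ (s = t ∨ t ∉ S) := by
      rcases hs with hs | hs
      · obtain ⟨p⟩ := hG.preconnected z z'
        exact ⟨Set.univ, ⟨p, fun _ _ => trivial⟩, .inl hs⟩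
      · rw [← hst] at hz hz'
        exact ⟨{t}ᶜ, hs z (fun h => hz (.inr h)) z' (fun h => hz' (.inr h)), .inr (by simp)⟩
    obtain ⟨S, hj, hS⟩ := hj
    obtain ⟨a, b, -, ha, hbS, hb, hab⟩ := hj.exit (self_mem_comp hz) hzz
    have hb' : b ∈ ({s, t} : Set V) := hst ▸ (hclosed z a ha b hab).resolve_left hb
    have hbs : b = s := by
      rcases hb' with h | h
      · exact h
      · obtain rfl : b = t := h
        rcases hS with h | h
        exacts [h.symm, absurd hbS h]
    exact ⟨s, rfl, a, ha, hbs ▸ hab.symm⟩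
  have hyx : ¬Joined G {u, w}ᶜ y x := fun h => hxy h.symm
  have hu' : w = u ∨ ConnOn G {u}ᶜ := hu.imp_left Eq.symm
  refine ⟨comp G {u, w}ᶜ x, comp G {u, w}ᶜ y, ?_, hclosed x, hnot x, hnot y, connOn_comp,
    connOn_comp,
    ⟨htouch x y hx hy hxy u w rfl hw, htouch x y hx hy hxy w u (Set.pair_comm _ _) hu'⟩,
    htouch y x hy hx hyx u w rfl hw, htouch y x hy hx hyx w u (Set.pair_comm _ _) hu'⟩
  exact Set.disjoint_left.2 fun z hzx hzy => hxy (hzx.trans hzy.symm)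

theorem exists_separation (hG : G.Connected) (h3 : ¬ThreeConn G) :
    ∃ u w A B, Separation G u w A B := by
  by_cases h : ∃ u, ¬ConnOn G {u}ᶜ
  · obtain ⟨u, hu⟩ := h
    rw [← Set.pair_eq_singleton] at hu
    exact ⟨u, u, separation_of_not_connOn hu (.inl rfl) (.inl rfl) hG⟩
  · push Not at h
    unfold ThreeConn at h3
    push Not at h3
    obtain ⟨u, w, huw⟩ := h3
    exact ⟨u, w, separation_of_not_connOn huw (.inr (h u)) (.inr (h w)) hG⟩

theorem exists_ne_of_card [Finite V] (h : 4 ≤ Nat.card V) (a b c : V) :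
    ∃ d, d ≠ a ∧ d ≠ b ∧ d ≠ c := by
  classical
  by_contra hd
  push Not at hd
  have huniv : (Set.univ : Set V) = ↑({a, b, c} : Finset V) := by
    ext d
    have := hd d
    simp only [Set.mem_univ, Finset.coe_insert, Finset.coe_singleton, Set.mem_insert_iff,
      Set.mem_singleton_iff, true_iff]
    tauto
  have := Finset.card_le_three (a := a) (b := b) (c := c)
  rw [← Set.ncard_coe_finset, ← huniv, Set.ncard_univ] at this
  omega

theorem hasTreewidthAtMost_of_radius {V : Type} [Finite V] {G : SimpleGraph V} (hG : Planar G)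
    {o : V} {r : ℕ} (hr : ∀ x, ∃ p : G.Walk o x, p.length ≤ r) :
    hasTreewidthAtMost G (3 * r) := by
  induction hn : Nat.card V using Nat.strong_induction_on generalizing V with
  | _ n ih =>
  subst hn
  by_cases hcard : Nat.card V ≤ 3 * r + 1
  · exact hasTreewidthAtMost_of_card_le hcard
  have hr0 : r ≠ 0 := by
    rintro rfl
    have : Subsingleton V := by
      refine subsingleton_of_forall_eq o fun x => ?_
      obtain ⟨p, hp⟩ := hr x
      exact (Walk.eq_of_length_eq_zero (Nat.le_zero.1 hp)).symm
    exact hcard (by simpa using Finite.card_le_one_iff_subsingleton.2 this)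
  by_cases h3 : ThreeConn G
  · exact hasTreewidthAtMost_of_threeConn hG h3 (exists_ne_of_card (by omega)) hr
  have hconn : G.Connected := by
    refine (SimpleGraph.connected_iff _).2 ⟨fun a b => ?_, ⟨o⟩⟩
    exact Reachable.trans ⟨(hr a).choose.reverse⟩ ⟨(hr b).choose⟩
  obtain ⟨u, w, A, B, h⟩ := exists_separation hconn h3
  have hside : ∀ S L : Set V, u ∈ S → w ∈ S → (∀ x ∈ S, ∀ y ∉ S, G.Adj x y → x = u ∨ x = w) →
      ConnOn G L → Disjoint L S → Touch G {u} L → Touch G {w} L →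
      hasTreewidthAtMost (torso G S u w) (3 * r) := by
    intro S L hu hw hS hL hLS hLu hLw
    obtain ⟨o', ho'⟩ := torso_radius hu hw hS hr
    refine ih _ ?_ (planar_torso hG hL hLS hLu hLw) ho' rfl
    obtain ⟨-, -, x, hx, -⟩ := hLu
    exact Finite.card_subtype_lt (Set.disjoint_left.1 hLS hx)
  refine hasTreewidthAtMost_of_torsos (S₁ := Aᶜ) (S₂ := A ∪ {u, w}) (u := u) (w := w)
    h.mem_left.1 h.mem_left.2 (by simp) (by simp) (fun x => ?_) (fun x hx hx' => ?_)
    (fun x y hxy => ?_) (hside _ A h.mem_left.1 h.mem_left.2 ?_ h.conn_left ?_ h.touch_left.1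
      h.touch_left.2) (hside _ B (by simp) (by simp) ?_ h.conn_right ?_ h.touch_right.1
      h.touch_right.2)
  · by_cases hx : x ∈ A
    exacts [.inr (.inl hx), .inl hx]
  · exact hx'.resolve_left hx
  · by_cases hx : x ∈ A
    · exact .inr ⟨.inl hx, h.left_closed x hx y hxy⟩
    · by_cases hy : y ∈ A
      · exact .inr ⟨h.left_closed y hy x hxy.symm, .inl hy⟩
      · exact .inl ⟨hx, hy⟩
  · intro x hx y hy hxy
    exact (h.left_closed y (not_not.1 hy) x hxy.symm).resolve_left hx
  · exact disjoint_compl_right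
  · rintro x (hx | hx) y hy hxy
    · exact absurd (h.left_closed x hx y hxy) hy
    · exact hx
  · rw [Set.disjoint_left]
    rintro x hxB (hx | rfl | rfl)
    exacts [Set.disjoint_left.1 h.disjoint hx hxB, h.mem_right.1 hxB, h.mem_right.2 hxB]

theorem exists_walk_ball (v : V) (r : ℕ) (x : {w | G.Reachable v w ∧ G.dist v w ≤ r}) :
    ∃ p : (G.induce {w | G.Reachable v w ∧ G.dist v w ≤ r}).Walk ⟨v, .refl v, by simp⟩ x,
      p.length ≤ r := by
  classical
  obtain ⟨p, hp⟩ := x.2.1.exists_walk_length_eq_dist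
  have hmem : ∀ z ∈ p.support, z ∈ {w | G.Reachable v w ∧ G.dist v w ≤ r} := fun z hz =>
    ⟨⟨p.takeUntil z hz⟩, (dist_le (p.takeUntil z hz)).trans <|
      (p.length_takeUntil_le_length hz).trans (hp.trans_le x.2.2)⟩
  refine ⟨p.induce _ hmem, ?_⟩
  rw [← Walk.length_map (Embedding.induce _).toHom, Walk.map_induce]
  exact hp.trans_le x.2.2

end

end LocalTreewidth

theorem stmt18 {V : Type*} [Fintype V] (G : SimpleGraph V) (hG : Planar G) :
    ∀ (v : V) (r : ℕ),
      hasTreewidthAtMost (G.induce {w | G.Reachable v w ∧ G.dist v w ≤ r}) (3 * r) := by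
  classical
  intro v r
  let e := Finite.equivFin {w | G.Reachable v w ∧ G.dist v w ≤ r}
  let i := SimpleGraph.Iso.map e (G.induce {w | G.Reachable v w ∧ G.dist v w ≤ r})
  refine LocalTreewidth.hasTreewidthAtMost_of_iso i
    (LocalTreewidth.hasTreewidthAtMost_of_radius (o := i ⟨v, .refl v, by simp⟩) ?_ fun x => ?_)
  · exact LocalTreewidth.planar_of_embedding hG
      ((SimpleGraph.Embedding.induce _).comp i.symm.toEmbedding)
  · obtain ⟨y, rfl⟩ := i.surjective x
    obtain ⟨p, hp⟩ := LocalTreewidth.exists_walk_ball v r y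
    exact ⟨p.map i.toHom, (SimpleGraph.Walk.length_map _ _).trans_le hp⟩
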